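/- arXiv:2310.12888 — 2 statements merged into one kernel-verified Lean document; each statement's English description precedes it below -/
import Mathlib

section
/- Let F be an algebraically closed field, let k ≥ 1, let I be a prime ideal of F[x_1,…,x_k] = MvPolynomial (Fin k) F, and let X := { x ∈ F^k : g(x) = 0 for all g ∈ I } be its zero locus. Assume X is not contained in any hyperplane through the origin: for every nonzero c ∈ F^k there exists x ∈ X with c_1 x_1 + ⋯ + c_k x_k ≠ 0. Then for every n ≥ 1 and every ℓ ≥ 2 there exist points v_1, …, v_n ∈ X such that for every family A_1, …, A_ℓ of subsets of {1,…,n} with |A_i| ≤ k for all i, with |A_1| + ⋯ + |A_ℓ| = (ℓ−1)·k, and having the dimension-k null intersection property, the intersection over i of the subspaces span_F{ v_j : j ∈ A_i } of F^k is the zero subspace. (In other words, an irreducible MDS variety is MDS(ℓ) for all ℓ ≥ 2: generic points of X form a higher order MDS code.) -/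
open Finset Matrix

noncomputable section

/-- The intersection `⋂_{j ∈ p} A j`, as a `Finset (Fin n)`. -/
def interSet {ℓ n : ℕ} (A : Fin ℓ → Finset (Fin n)) (p : Finset (Fin ℓ)) : Finset (Fin n) :=
  Finset.univ.filter fun x => ∀ j ∈ p, x ∈ A j

/-- The dimension-`m` null intersection property: for every partition of `{1,…,ℓ}`
(presented as a `Finpartition` of `Finset.univ : Finset (Fin ℓ)`) into nonempty parts
`P_1,…,P_s`, we have `Σ_i |⋂_{j ∈ P_i} A_j| ≤ (s-1)·m`. -/
def NullInter {ℓ n : ℕ} (m : ℕ) (A : Fin ℓ → Finset (Fin n)) : Prop :=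
  ∀ P : Finpartition (Finset.univ : Finset (Fin ℓ)),
    ∑ p ∈ P.parts, (interSet A p).card ≤ (P.parts.card - 1) * m

/-- Span of the columns of `M` indexed by `A`. -/
def colSpan {K : Type*} [Field K] {k n : ℕ} (M : Matrix (Fin k) (Fin n) K)
    (A : Finset (Fin n)) : Submodule K (Fin k → K) :=
  Submodule.span K ((fun j i => M i j) '' (A : Set (Fin n)))

/-- Span of the first `σ` columns of `M`. -/
def colSpanLT {K : Type*} [Field K] {k b : ℕ} (M : Matrix (Fin k) (Fin b) K)
    (σ : ℕ) : Submodule K (Fin k → K) :=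
  Submodule.span K ((fun j i => M i j) '' {j : Fin b | (j : ℕ) < σ})

/-- The minimum of `σ` over the set `p` (for nonempty `p`, this is `min_{j ∈ p} σ j`). -/
def partMin {ℓ : ℕ} (σ : Fin ℓ → ℕ) (p : Finset (Fin ℓ)) : ℕ :=
  sInf (σ '' (p : Set (Fin ℓ)))

/-- The generic intersection dimension `gid_m((σ_i, A_i)_i)`: the maximum over all
partitions of `{1,…,ℓ}` into nonempty parts `P_1,…,P_s` of
`-m(s-1) + Σ_i (min_{j ∈ P_i} σ_j + |⋂_{j ∈ P_i} A_j|)`. -/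
def gid {ℓ n : ℕ} (m : ℕ) (σ : Fin ℓ → ℕ) (A : Fin ℓ → Finset (Fin n)) : ℤ :=
  sSup { v : ℤ | ∃ P : Finpartition (Finset.univ : Finset (Fin ℓ)),
    v = -(m : ℤ) * ((P.parts.card : ℤ) - 1)
      + ∑ p ∈ P.parts, ((partMin σ p : ℤ) + ((interSet A p).card : ℤ)) }





theorem exists_closed_valuation (F K : Type*) [Field F] [IsAlgClosed F] [Field K] [Algebra F K] :
    ∃ O : ValuationSubring K, (∀ c : F, algebraMap F K c ∈ O) ∧
      ∀ a ∈ O, ∃ c : F, O.valuation (a - algebraMap F K c) < 1 := by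
  classical
  let S : Set (Set K) := {s | ∃ O : ValuationSubring K, (O : Set K) = s ∧
    ∀ c : F, algebraMap F K c ∈ O}
  obtain ⟨m, hm⟩ := zorn_superset_nonempty S (by
    intro c hc hchain hne
    have hc' : ∀ s ∈ c, ∃ O : ValuationSubring K, (O : Set K) = s ∧
      ∀ c : F, algebraMap F K c ∈ O := fun s hs => hc hs
    choose! O hO hO' using hc'
    have hmem : ∀ s ∈ c, ∀ x, x ∈ O s ↔ x ∈ s := fun s hs x => by
      rw [← SetLike.mem_coe, hO s hs]
    let R : Subring K := ⨅ s : c, (O s.1).toSubring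
    have hR : ∀ x, x ∈ R ↔ ∀ s ∈ c, x ∈ s := by
      intro x
      simp only [R, Subring.mem_iInf, Subtype.forall, ValuationSubring.mem_toSubring]
      exact forall₂_congr fun s hs => hmem s hs x
    refine ⟨R, ⟨ValuationSubring.ofSubring R ?_, rfl, ?_⟩, ?_⟩
    · intro x
      by_contra hcon
      push Not at hcon
      rw [hR, hR] at hcon
      push Not at hcon
      obtain ⟨⟨s, hs, hxs⟩, ⟨t, ht, hxt⟩⟩ := hcon
      have h1 := ((O s).mem_or_inv_mem x).resolve_left (by rwa [hmem s hs])
      have h2 := ((O t).mem_or_inv_mem x).resolve_right (by rwa [hmem t ht])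
      rw [hmem s hs] at h1
      rw [hmem t ht] at h2
      rcases hchain.total hs ht with h | h
      · exact hxt (h h1)
      · exact hxs (h h2)
    · intro a
      rw [ValuationSubring.mem_ofSubring, hR]
      intro s hs
      rw [← hmem s hs]
      exact hO' s hs a
    · intro s hs x hx
      exact (hR x).1 hx s hs) Set.univ ⟨⊤, rfl, fun _ => ValuationSubring.mem_top _⟩
  obtain ⟨-, ⟨O, rfl, hF⟩, hmin⟩ := hm
  refine ⟨O, hF, ?_⟩
  by_contra hcon
  push Not at hcon
  obtain ⟨a, haO, ha⟩ := hcon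
  let i : F →+* O := (algebraMap F K).codRestrict O.toSubring hF
  let r := (IsLocalRing.residue O)
  let _ : Algebra F (IsLocalRing.ResidueField O) := (r.comp i).toAlgebra
  have hta : r ⟨a, haO⟩ ∉ (algebraMap F (IsLocalRing.ResidueField O)).range := by
    rintro ⟨c, hc⟩
    have : r (⟨a, haO⟩ - i c) = 0 := by
      rw [map_sub, ← hc, sub_eq_zero]; rfl
    rw [IsLocalRing.residue_eq_zero_iff, ValuationSubring.valuation_lt_one_iff] at this
    exact absurd this (not_lt.2 (ha c))
  have : IsIntegrallyClosedIn (algebraMap F (IsLocalRing.ResidueField O)).range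
      (IsLocalRing.ResidueField O) := by
    rw [Subring.isIntegrallyClosedIn_iff]
    intro x hx
    have hx' : IsIntegral F x := by
      obtain ⟨p, hp, hpx⟩ := hx
      have hs : Function.Surjective (algebraMap F (IsLocalRing.ResidueField O)).rangeRestrict :=
        RingHom.rangeRestrict_surjective _
      obtain ⟨q, hq, -, hq'⟩ := Polynomial.lifts_and_natDegree_eq_and_monic
        (f := (algebraMap F (IsLocalRing.ResidueField O)).rangeRestrict)
        (p := p) ((Polynomial.mem_lifts _).2 (Polynomial.map_surjective _ hs p)) hp
      refine ⟨q, hq', ?_⟩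
      rw [← hq, Polynomial.eval₂_map] at hpx
      exact hpx
    have : Algebra.IsAlgebraic F (IntermediateField.adjoin F {x}) :=
      IntermediateField.isAlgebraic_adjoin_simple hx'
    have := IntermediateField.eq_bot_of_isAlgClosed_of_isAlgebraic (IntermediateField.adjoin F {x})
    have h2 := IntermediateField.mem_adjoin_simple_self F x
    rw [this] at h2
    obtain ⟨y, hy⟩ := h2
    exact ⟨y, hy⟩
  obtain ⟨V, hV, hVa⟩ := Subring.exists_le_valuationSubring_of_isIntegrallyClosedIn hta
  let R : Subring K := (V.toSubring.comap r).map O.subtype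
  have hR : ∀ x (hx : x ∈ O), x ∈ R ↔ r ⟨x, hx⟩ ∈ V := by
    intro x hx
    constructor
    · rintro ⟨y, hy, rfl⟩
      exact hy
    · intro h
      exact ⟨⟨x, hx⟩, h, rfl⟩
  have hRV : ∀ x : K, x ∈ R ∨ x⁻¹ ∈ R := by
    have key : ∀ x ∈ O, x ∈ R ∨ x⁻¹ ∈ R := by
      intro x hx
      by_cases h : IsUnit (⟨x, hx⟩ : O)
      · obtain ⟨⟨y, hy⟩, hxy⟩ := h.exists_right_inv
        have hxy' : x * y = 1 := congrArg Subtype.val hxy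
        have hyx : x⁻¹ = y := inv_eq_of_mul_eq_one_right hxy'
        rw [hyx, hR x hx, hR y hy]
        have h3 : r ⟨x, hx⟩ * r ⟨y, hy⟩ = 1 := by rw [← map_mul, hxy, map_one]
        have := V.mem_or_inv_mem (r ⟨x, hx⟩)
        rwa [inv_eq_of_mul_eq_one_right h3] at this
      · left
        rw [hR x hx]
        have : r ⟨x, hx⟩ = 0 := (IsLocalRing.residue_eq_zero_iff _).2 h
        rw [this]; exact V.zero_mem
    intro x
    rcases O.mem_or_inv_mem x with h | h
    · exact key x h
    · have := key _ h
      rw [inv_inv] at this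
      exact this.symm
  have hle : (R : Set K) ⊆ (O : Set K) := by
    rintro _ ⟨y, -, rfl⟩
    exact y.2
  have := hmin (y := (R : Set K)) ⟨ValuationSubring.ofSubring R hRV, rfl, fun c => by
    rw [ValuationSubring.mem_ofSubring, hR _ (hF c)]
    exact hV ⟨c, rfl⟩⟩ hle
  exact hVa ((hR a haO).1 (this haO))


theorem exists_flag_basis {F K : Type*} [Field F] [Field K] [Algebra F K]
    (O : ValuationSubring K) (hF : ∀ c : F, algebraMap F K c ∈ O)
    (hres : ∀ a ∈ O, ∃ c : F, O.valuation (a - algebraMap F K c) < 1) (k : ℕ) :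
    ∀ L : Submodule F K, FiniteDimensional F L → Module.finrank F L = k →
      ∃ f : Fin k → K, (∀ j, f j ∈ L) ∧ (∀ i j, i < j → O.valuation (f j) < O.valuation (f i)) ∧
        (∀ j, f j ≠ 0) ∧ LinearIndependent F f := by
  have hsm : ∀ (c : F) (x : K), O.valuation (c • x) ≤ O.valuation x := by
    intro c x
    rw [Algebra.smul_def, map_mul]
    exact mul_le_of_le_one_left' ((O.valuation_le_one_iff _).2 (hF c))
  induction k with
  | zero =>
    intro L _ _
    exact ⟨Fin.elim0, fun j => j.elim0, fun j => j.elim0, fun j => j.elim0,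
      linearIndependent_empty_type⟩
  | succ k ih =>
    intro L hL hfr
    obtain ⟨s, hs⟩ := (Module.Finite.iff_fg.1 hL)
    have hLne : L ≠ ⊥ := by
      rintro rfl
      simp at hfr
    have hsne : s.Nonempty := by
      rw [Finset.nonempty_iff_ne_empty]
      rintro rfl
      apply hLne
      rw [← hs]; simp
    obtain ⟨f0, hf0s, hmax⟩ := s.exists_max_image (fun x => O.valuation x) hsne
    have hf0 : f0 ∈ L := by rw [← hs]; exact Submodule.subset_span hf0s
    have hmaxL : ∀ x ∈ L, O.valuation x ≤ O.valuation f0 := by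
      intro x hx
      rw [← hs] at hx
      induction hx using Submodule.span_induction with
      | mem x hx => exact hmax x hx
      | zero => simp
      | add x y _ _ hx hy => exact (O.valuation.map_add_le hx hy)
      | smul c x _ hx => exact (hsm c x).trans hx
    have hf00 : f0 ≠ 0 := by
      rintro rfl
      apply hLne
      rw [eq_bot_iff]
      intro x hx
      have := hmaxL x hx
      simpa using this
    have hv0 : 0 < O.valuation f0 := by
      rw [zero_lt_iff]; simpa using hf00
    let L' : Submodule F K :=
      { carrier := {x | x ∈ L ∧ O.valuation x < O.valuation f0}
        add_mem' := fun {x y} hx hy => ⟨L.add_mem hx.1 hy.1, O.valuation.map_add_lt hx.2 hy.2⟩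
        zero_mem' := ⟨L.zero_mem, by simpa using hv0⟩
        smul_mem' := fun c x hx => ⟨L.smul_mem c hx.1, (hsm c x).trans_lt hx.2⟩ }
    have hL'L : L' ≤ L := fun x hx => hx.1
    have hfd' : FiniteDimensional F L' := Submodule.finiteDimensional_of_le hL'L
    have hnot : f0 ∉ L' := fun h => lt_irrefl _ h.2
    have hsup : (F ∙ f0) ⊔ L' = L := by
      apply le_antisymm
      · rw [sup_le_iff, Submodule.span_singleton_le_iff_mem]
        exact ⟨hf0, hL'L⟩
      · intro x hx
        have hq : x / f0 ∈ O := by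
          rw [← O.valuation_le_one_iff, map_div₀]
          exact div_le_one_of_le₀ (hmaxL x hx) zero_le
        obtain ⟨c, hc⟩ := hres _ hq
        have hx' : x - c • f0 ∈ L' := by
          refine ⟨L.sub_mem hx (L.smul_mem c hf0), ?_⟩
          have : x - c • f0 = (x / f0 - algebraMap F K c) * f0 := by
            rw [Algebra.smul_def]; field_simp
          rw [this, map_mul]
          exact mul_lt_of_lt_one_left hv0 hc
        rw [← add_sub_cancel (c • f0) x]
        exact Submodule.add_mem_sup (Submodule.smul_mem _ _ (Submodule.mem_span_singleton_self _)) hx'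
    have hinf : (F ∙ f0) ⊓ L' = ⊥ := by
      rw [← disjoint_iff, disjoint_comm, Submodule.disjoint_span_singleton' hf00]
      exact hnot
    have hrank := Submodule.finrank_sup_add_finrank_inf_eq (F ∙ f0) L'
    rw [hsup, hinf, hfr, finrank_span_singleton hf00] at hrank
    simp at hrank
    obtain ⟨f, hfL, hfv, hfn, hfi⟩ := ih L' hfd' (by omega)
    refine ⟨Fin.cons f0 f, ?_, ?_, ?_, ?_⟩
    · intro j
      refine Fin.cases hf0 (fun j => hL'L (hfL j)) j
    · intro i j
      refine Fin.cases ?_ (fun i => ?_) i <;> refine Fin.cases ?_ (fun j => ?_) j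
      · intro h; exact absurd h (lt_irrefl _)
      · intro _; simpa using (hfL j).2
      · intro h; exact absurd h (by simp)
      · intro h; simpa using hfv i j (by simpa using h)
    · intro j
      refine Fin.cases hf00 (fun j => ?_) j
      simpa using hfn j
    · rw [linearIndependent_finCons]
      refine ⟨hfi, fun h => hnot ?_⟩
      exact (Submodule.span_le.2 (by rintro _ ⟨j, rfl⟩; exact hfL j)) h


theorem exists_place {F K : Type*} [Field F] [Field K] [Algebra F K]
    (O : ValuationSubring K) (hF : ∀ c : F, algebraMap F K c ∈ O)
    (hres : ∀ a ∈ O, ∃ c : F, O.valuation (a - algebraMap F K c) < 1) :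
    ∃ ρ : O →+* F, (∀ a : O, ρ a = 0 ↔ O.valuation (a : K) < 1) ∧
      ∀ c : F, ρ ⟨algebraMap F K c, hF c⟩ = c := by
  let i : F →+* O := (algebraMap F K).codRestrict O.toSubring hF
  let r := (IsLocalRing.residue O)
  have hb : Function.Bijective (r.comp i) := by
    refine ⟨(r.comp i).injective, fun y => ?_⟩
    obtain ⟨⟨a, ha⟩, rfl⟩ := IsLocalRing.residue_surjective y
    obtain ⟨c, hc⟩ := hres a ha
    refine ⟨c, ?_⟩
    have : r (⟨a, ha⟩ - i c) = 0 := by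
      rw [IsLocalRing.residue_eq_zero_iff, ValuationSubring.valuation_lt_one_iff]
      exact hc
    rw [map_sub, sub_eq_zero] at this
    exact this.symm
  let e := RingEquiv.ofBijective _ hb
  refine ⟨e.symm.toRingHom.comp r, fun a => ?_, fun c => ?_⟩
  · rw [← ValuationSubring.valuation_lt_one_iff, ← IsLocalRing.residue_eq_zero_iff]
    simp [r]
  · exact e.symm_apply_apply c

theorem exists_minor {E m a : Type*} [Field E] [Fintype m] [Fintype a] [DecidableEq a]
    (N : Matrix m a E) (hN : ∀ u, N *ᵥ u = 0 → u = 0) :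
    ∃ e : a → m, (N.submatrix e id).det ≠ 0 := by
  have hinj : Function.Injective N.mulVecLin := by
    rw [← LinearMap.ker_eq_bot, LinearMap.ker_eq_bot']
    exact hN
  have hr : N.rank = Fintype.card a := by
    rw [Matrix.rank, LinearMap.finrank_range_of_inj hinj, Module.finrank_fintype_fun_eq_card]
  rw [Matrix.rank_eq_finrank_span_row] at hr
  have htop : Submodule.span E (Set.range N.row) = ⊤ := by
    apply Submodule.eq_top_of_finrank_eq
    rw [hr, Module.finrank_fintype_fun_eq_card]
  obtain ⟨κ, g, hg, hsp, hli⟩ := exists_linearIndependent' E N.row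
  rw [htop] at hsp
  have : Fintype κ := Fintype.ofInjective g hg
  let b := Module.Basis.mk hli hsp.ge
  have hcard : Fintype.card a = Fintype.card κ := by
    rw [← Module.finrank_fintype_fun_eq_card E (η := a), Module.finrank_eq_card_basis b]
  let q : a ≃ κ := Fintype.equivOfCardEq hcard
  refine ⟨g ∘ q, ?_⟩
  have hli2 : LinearIndependent E (N.submatrix (g ∘ q) id).row := hli.comp q q.injective
  rw [Matrix.linearIndependent_rows_iff_isUnit, Matrix.isUnit_iff_isUnit_det] at hli2
  exact hli2.ne_zero

/-- Independence of the spaces `U_i`. -/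
def Ind {ι E : Type*} [Field E] {k n : ℕ} (S : Finset ι) (σ : ι → ℕ) (A : ι → Finset (Fin n))
    (v : Fin n → Fin k → E) : Prop :=
  ∀ u : ι → Fin k → E, (∀ i ∈ S, ∀ t : Fin k, (t : ℕ) < σ i → u i t = 0) →
    (∀ i ∈ S, ∀ j ∈ A i, ∑ t, v j t * u i t = 0) →
    (∀ t, ∑ i ∈ S, u i t = 0) → ∀ i ∈ S, u i = 0

open Classical in
/-- The matrix of the linear system. -/
def Nmat {ι R : Type*} [CommRing R] {k n : ℕ} (S : Finset ι) (σ : ι → ℕ) (A : ι → Finset (Fin n))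
    (v : Fin n → Fin k → R) : Matrix (Fin k ⊕ (ι × Fin k) ⊕ (ι × Fin n)) (ι × Fin k) R :=
  fun r c => match r with
  | Sum.inl t => if c.2 = t then (if c.1 ∈ S then 1 else 0) else 0
  | Sum.inr (Sum.inl p) => if p = c then (if c.1 ∉ S ∨ (c.2 : ℕ) < σ c.1 then 1 else 0) else 0
  | Sum.inr (Sum.inr p) => if c.1 = p.1 then (if p.1 ∈ S ∧ p.2 ∈ A p.1 then v p.2 c.2 else 0) else 0

theorem Nmat_map {ι R R' : Type*} [CommRing R] [CommRing R'] {k n : ℕ} (S : Finset ι) (σ : ι → ℕ)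
    (A : ι → Finset (Fin n)) (v : Fin n → Fin k → R) (φ : R →+* R') :
    (Nmat S σ A v).map φ = Nmat S σ A (fun j t => φ (v j t)) := by
  ext r c
  rcases r with t | p | p <;> simp only [Nmat, Matrix.map_apply] <;> split_ifs <;> simp

theorem Nmat_mulVec {ι R : Type*} [Fintype ι] [CommRing R] {k n : ℕ} (S : Finset ι) (σ : ι → ℕ)
    (A : ι → Finset (Fin n)) (v : Fin n → Fin k → R) (u : ι × Fin k → R) :
    (Nmat S σ A v) *ᵥ u = 0 ↔ (∀ t, ∑ i ∈ S, u (i, t) = 0) ∧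
      (∀ i, ∀ t : Fin k, (i ∉ S ∨ (t : ℕ) < σ i) → u (i, t) = 0) ∧
      (∀ i ∈ S, ∀ j ∈ A i, ∑ t, v j t * u (i, t) = 0) := by
  classical
  rw [funext_iff]
  simp only [Sum.forall, Pi.zero_apply]
  refine and_congr ?_ (and_congr ?_ ?_)
  · refine forall_congr' fun t => ?_
    simp [Nmat, Matrix.mulVec, dotProduct, Fintype.sum_prod_type, ite_mul]
  · simp only [Prod.forall]
    refine forall₂_congr fun i t => ?_
    simp [Nmat, Matrix.mulVec, dotProduct, ite_mul]
  · simp only [Prod.forall]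
    refine forall_congr' fun i => ?_
    have : ∀ j, (Nmat S σ A v *ᵥ u) (Sum.inr (Sum.inr (i, j))) =
        if i ∈ S ∧ j ∈ A i then ∑ t, v j t * u (i, t) else 0 := by
      intro j
      simp only [Nmat, Matrix.mulVec, dotProduct, Fintype.sum_prod_type]
      rw [Finset.sum_eq_single i]
      · simp only [if_true]
        split_ifs <;> simp
      · intro b _ hb
        simp [hb]
      · simp
    constructor
    · intro h hi j hj
      have h1 := h j
      rwa [this, if_pos ⟨hi, hj⟩] at h1
    · intro h j
      rw [this]
      split_ifs with h1
      · exact h h1.1 j h1.2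
      · rfl

theorem Ind_iff {ι E : Type*} [Fintype ι] [Field E] {k n : ℕ} (S : Finset ι) (σ : ι → ℕ)
    (A : ι → Finset (Fin n)) (v : Fin n → Fin k → E) :
    Ind S σ A v ↔ ∀ u, (Nmat S σ A v) *ᵥ u = 0 → u = 0 := by
  classical
  constructor
  · intro h u hu
    rw [Nmat_mulVec] at hu
    obtain ⟨h1, h2, h3⟩ := hu
    have := h (fun i t => u (i, t)) (fun i _ t ht => h2 i t (Or.inr ht)) h3 h1
    ext ⟨i, t⟩
    by_cases hi : i ∈ S
    · exact congrFun (this i hi) t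
    · exact h2 i t (Or.inl hi)
  · intro h u h1 h2 h3 i hi
    have := h (fun p => if p.1 ∈ S then u p.1 p.2 else 0) (by
      rw [Nmat_mulVec]
      refine ⟨fun t => ?_, fun i t hit => ?_, fun i hi j hj => ?_⟩
      · rw [← h3 t]
        exact Finset.sum_congr rfl fun i hi => by simp [hi]
      · by_cases hi : i ∈ S
        · simp [hi, h1 i hi t (hit.resolve_left (not_not.2 hi))]
        · simp [hi]
      · rw [← h2 i hi j hj]
        simp [hi])
    ext t
    have := congrFun this (i, t)
    simpa [hi] using this

open MvPolynomial in
theorem Ind_open {ι F E : Type*} [Fintype ι] [Field F] [Field E] [Algebra F E] {k n : ℕ}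
    (S : Finset ι) (σ : ι → ℕ) (A : ι → Finset (Fin n)) (v : Fin n → Fin k → E)
    (h : Ind S σ A v) :
    ∃ P : MvPolynomial (Fin n × Fin k) F, aeval (fun p => v p.1 p.2) P ≠ 0 ∧
      ∀ v' : Fin n → Fin k → F, eval (fun p => v' p.1 p.2) P ≠ 0 → Ind S σ A v' := by
  classical
  rw [Ind_iff] at h
  obtain ⟨e, he⟩ := exists_minor _ h
  refine ⟨((Nmat S σ A (fun j t => X (j, t))).submatrix e id).det, ?_, ?_⟩
  · rw [AlgHom.map_det]
    convert he
    rw [AlgHom.mapMatrix_apply, ← Matrix.submatrix_map]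
    congr 1
    have := Nmat_map S σ A (fun j t => (X (j, t) : MvPolynomial (Fin n × Fin k) F))
      (aeval (fun p => v p.1 p.2) : MvPolynomial (Fin n × Fin k) F →ₐ[F] E).toRingHom
    simpa using this
  · intro v' hv'
    rw [RingHom.map_det, RingHom.mapMatrix_apply, ← Matrix.submatrix_map, Nmat_map] at hv'
    simp only [eval_X] at hv'
    rw [Ind_iff]
    intro u hu
    apply Matrix.eq_zero_of_mulVec_eq_zero hv'
    ext i
    exact congrFun hu (e i)

/-- Substituting constants for all but one of the points. -/
def substP {F : Type*} [Field F] {k n : ℕ} (v : Fin n → Fin k → F) (j : Fin n)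
    (P : MvPolynomial (Fin n × Fin k) F) : MvPolynomial (Fin k) F :=
  MvPolynomial.aeval (fun q : Fin n × Fin k =>
    Function.update (fun i t => MvPolynomial.C (v i t)) j (fun t => MvPolynomial.X t) q.1 q.2) P

theorem aeval_substP {F E : Type*} [Field F] [Field E] [Algebra F E] {k n : ℕ}
    (v : Fin n → Fin k → F) (j : Fin n)
    (P : MvPolynomial (Fin n × Fin k) F) (x : Fin k → E) :
    MvPolynomial.aeval x (substP v j P) = MvPolynomial.aeval (fun q : Fin n × Fin k =>
      Function.update (fun i t => algebraMap F E (v i t)) j x q.1 q.2) P := by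
  rw [substP, ← AlgHom.comp_apply, MvPolynomial.comp_aeval]
  congr 2
  ext q
  by_cases h : q.1 = j
  · simp [h]
  · simp [h]

theorem eval_substP {F : Type*} [Field F] {k n : ℕ}
    (v : Fin n → Fin k → F) (j : Fin n)
    (P : MvPolynomial (Fin n × Fin k) F) (x : Fin k → F) :
    MvPolynomial.eval x (substP v j P) = MvPolynomial.eval (fun q : Fin n × Fin k =>
      Function.update v j x q.1 q.2) P := by
  have := aeval_substP (E := F) v j P x
  simpa [MvPolynomial.aeval_eq_eval] using this

theorem irred_prod {F K : Type*} [Field F] [Field K] [Algebra F K] {k n : ℕ}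
    (f : Fin k → K) (Y : Set (Fin k → F))
    (hgen : ∀ p : MvPolynomial (Fin k) F,
      MvPolynomial.aeval f p ≠ 0 ↔ ∃ y ∈ Y, MvPolynomial.eval y p ≠ 0)
    (P Q : MvPolynomial (Fin n × Fin k) F) (v w : Fin n → Fin k → F)
    (hv : ∀ j, v j ∈ Y) (hw : ∀ j, w j ∈ Y)
    (hP : MvPolynomial.eval (fun q => v q.1 q.2) P ≠ 0)
    (hQ : MvPolynomial.eval (fun q => w q.1 q.2) Q ≠ 0) :
    ∃ u : Fin n → Fin k → F, (∀ j, u j ∈ Y) ∧ MvPolynomial.eval (fun q => u q.1 q.2) P ≠ 0 ∧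
      MvPolynomial.eval (fun q => u q.1 q.2) Q ≠ 0 := by
  classical
  have key : ∀ s : Finset (Fin n), ∃ v w : Fin n → Fin k → F, (∀ j, v j ∈ Y) ∧ (∀ j, w j ∈ Y) ∧
      MvPolynomial.eval (fun q => v q.1 q.2) P ≠ 0 ∧
      MvPolynomial.eval (fun q => w q.1 q.2) Q ≠ 0 ∧ ∀ j ∈ s, v j = w j := by
    intro s
    induction s using Finset.induction_on with
    | empty => exact ⟨v, w, hv, hw, hP, hQ, by simp⟩
    | insert j s hj ih =>
      obtain ⟨v, w, hv, hw, hP, hQ, hs⟩ := ih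
      have h1 : MvPolynomial.aeval f (substP v j P) ≠ 0 := by
        rw [hgen]
        exact ⟨v j, hv j, by rwa [eval_substP, Function.update_eq_self]⟩
      have h2 : MvPolynomial.aeval f (substP w j Q) ≠ 0 := by
        rw [hgen]
        exact ⟨w j, hw j, by rwa [eval_substP, Function.update_eq_self]⟩
      have h3 : MvPolynomial.aeval f (substP v j P * substP w j Q) ≠ 0 := by
        rw [map_mul]; exact mul_ne_zero h1 h2
      rw [hgen] at h3
      obtain ⟨y, hy, hyne⟩ := h3
      rw [map_mul, eval_substP, eval_substP] at hyne
      refine ⟨Function.update v j y, Function.update w j y, ?_, ?_, left_ne_zero_of_mul hyne,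
        right_ne_zero_of_mul hyne, ?_⟩
      · intro i
        by_cases h : i = j
        · subst h; simpa using hy
        · simpa [h] using hv i
      · intro i
        by_cases h : i = j
        · subst h; simpa using hy
        · simpa [h] using hw i
      · intro i hi
        by_cases h : i = j
        · subst h; simp
        · simpa [h] using hs i (Finset.mem_of_mem_insert_of_ne hi h)
  obtain ⟨v, w, hv, hw, hP, hQ, hs⟩ := key Finset.univ
  have : v = w := funext fun j => hs j (Finset.mem_univ j)
  subst this
  exact ⟨v, hv, hP, hQ⟩

theorem merge_generic {ι F K : Type*} [Field F] [Field K] [Algebra F K] {k n : ℕ}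
    (O : ValuationSubring K) (hF : ∀ c : F, algebraMap F K c ∈ O)
    (ρ : O →+* F) (hρ : ∀ a : O, ρ a = 0 ↔ O.valuation (a : K) < 1)
    (hρF : ∀ c : F, ρ ⟨algebraMap F K c, hF c⟩ = c)
    (f : Fin k → K) (hf0 : ∀ j, f j ≠ 0)
    (hfv : ∀ i j, i < j → O.valuation (f j) < O.valuation (f i))
    (S : Finset ι) (σ : ι → ℕ) (A : ι → Finset (Fin n)) (v : Fin n → Fin k → F) (j : Fin n)
    (h : Ind S (fun i => if j ∈ A i then σ i + 1 else σ i) (fun i => (A i).erase j) v) :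
    Ind S σ A (Function.update (fun i t => algebraMap F K (v i t)) j f) := by
  classical
  intro u h1 h2 h3
  by_contra hcon
  push Not at hcon
  obtain ⟨i1, hi1, hu1⟩ := hcon
  obtain ⟨t1, ht1⟩ := Function.ne_iff.1 hu1
  obtain ⟨⟨i0, t0⟩, hm, hmax⟩ := (S ×ˢ (Finset.univ : Finset (Fin k))).exists_max_image
    (fun p => O.valuation (u p.1 p.2)) ⟨(i1, t1), by simp [hi1]⟩
  have hi0 : i0 ∈ S := by simpa using hm
  have hne : u i0 t0 ≠ 0 := by
    intro h0
    have := hmax (i1, t1) (by simp [hi1])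
    simp only [h0, map_zero, le_zero_iff, map_eq_zero] at this
    exact ht1 this
  have hO : ∀ i ∈ S, ∀ t, u i t / u i0 t0 ∈ O := by
    intro i hi t
    rw [← O.valuation_le_one_iff, map_div₀]
    exact div_le_one_of_le₀ (hmax (i, t) (by simp [hi])) zero_le
  let a : ι → Fin k → O := fun i t => if h : u i t / u i0 t0 ∈ O then ⟨_, h⟩ else 0
  have ha : ∀ i ∈ S, ∀ t, (a i t : K) = u i t / u i0 t0 := by
    intro i hi t
    simp only [a, dif_pos (hO i hi t)]
  have ha0 : ∀ i ∈ S, ∀ t : Fin k, (t : ℕ) < σ i → a i t = 0 := by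
    intro i hi t ht
    apply Subtype.ext
    rw [ha i hi, h1 i hi t ht, zero_div]; rfl
  have hb := h (fun i t => ρ (a i t)) ?_ ?_ ?_ i0 hi0
  · have := congrFun hb t0
    have h4 : a i0 t0 = 1 := by
      apply Subtype.ext
      rw [ha i0 hi0, div_self hne]; rfl
    simp [h4] at this
  · intro i hi t ht
    beta_reduce at ht
    by_cases hlt : (t : ℕ) < σ i
    · show ρ (a i t) = 0
      rw [ha0 i hi t hlt, map_zero]
    · have hj : j ∈ A i := by
        by_contra hj
        rw [if_neg hj] at ht
        exact hlt ht
      rw [if_pos hj] at ht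
      have hts : (t : ℕ) = σ i := by omega
      show ρ (a i t) = 0
      rw [hρ]
      have heq : ∑ s, f s * (a i s : K) = 0 := by
        have := h2 i hi j hj
        simp only [Function.update_self] at this
        calc ∑ s, f s * (a i s : K) = (∑ s, f s * u i s) / u i0 t0 := by
              rw [Finset.sum_div]
              exact Finset.sum_congr rfl fun s _ => by rw [ha i hi, mul_div_assoc]
          _ = 0 := by rw [this, zero_div]
      rw [← Finset.add_sum_erase _ _ (Finset.mem_univ t)] at heq
      have heq2 := eq_neg_of_add_eq_zero_left heq
      have hft : 0 < O.valuation (f t) := by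
        rw [zero_lt_iff]; simpa using hf0 t
      have hlt2 : O.valuation (f t * (a i t : K)) < O.valuation (f t) := by
        rw [heq2, Valuation.map_neg]
        apply Valuation.map_sum_lt _ hft.ne'
        intro s hs
        by_cases hst : (s : ℕ) < σ i
        · rw [ha0 i hi s hst]
          simpa using hft
        · have : t < s := by
            rw [Fin.lt_def]
            have : s ≠ t := Finset.ne_of_mem_erase hs
            have : (s : ℕ) ≠ t := fun h => this (Fin.ext h)
            omega
          rw [map_mul]
          exact (mul_le_of_le_one_right' (O.valuation_le_one _)).trans_lt (hfv t s this)
      rw [map_mul] at hlt2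
      by_contra hge
      push Not at hge
      exact absurd hlt2 (not_lt.2 (le_mul_of_one_le_right' hge))
  · intro i hi j' hj'
    have hne' : j' ≠ j := Finset.ne_of_mem_erase hj'
    have h5 := h2 i hi j' (Finset.mem_of_mem_erase hj')
    simp only [Function.update_of_ne hne'] at h5
    have h6 : ∑ t, (⟨algebraMap F K (v j' t), hF _⟩ : O) * a i t = 0 := by
      apply Subtype.ext
      push_cast
      calc _ = (∑ t, algebraMap F K (v j' t) * u i t) / u i0 t0 := by
              rw [Finset.sum_div]
              exact Finset.sum_congr rfl fun s _ => by rw [ha i hi, mul_div_assoc]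
        _ = 0 := by rw [h5, zero_div]
        _ = _ := rfl
    have h7 := congrArg ρ h6
    simpa [map_sum, hρF] using h7
  · intro t
    have h6 : ∑ i ∈ S, a i t = 0 := by
      apply Subtype.ext
      push_cast
      calc _ = (∑ i ∈ S, u i t) / u i0 t0 := by
              rw [Finset.sum_div]
              exact Finset.sum_congr rfl fun s hs => by rw [ha s hs]
        _ = 0 := by rw [h3, zero_div]
        _ = _ := rfl
    have h7 := congrArg ρ h6
    simpa [map_sum] using h7

/-- The data of a variety together with a place at its generic point. -/
structure Setup (F K : Type*) [Field F] [Field K] [Algebra F K] (k : ℕ) (f : Fin k → K)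
    (Y : Set (Fin k → F)) : Prop where
  hgen : ∀ p : MvPolynomial (Fin k) F,
      MvPolynomial.aeval f p ≠ 0 ↔ ∃ y ∈ Y, MvPolynomial.eval y p ≠ 0
  hplace : ∃ (O : ValuationSubring K) (hF : ∀ c : F, algebraMap F K c ∈ O) (ρ : O →+* F),
    (∀ a : O, ρ a = 0 ↔ O.valuation (a : K) < 1) ∧
    (∀ c : F, ρ ⟨algebraMap F K c, hF c⟩ = c) ∧ (∀ j, f j ≠ 0) ∧
    (∀ i j, i < j → O.valuation (f j) < O.valuation (f i))

theorem Setup.merge {ι F K : Type*} [Fintype ι] [Field F] [Field K] [Algebra F K] {k n : ℕ}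
    {f : Fin k → K} {Y : Set (Fin k → F)} (H : Setup F K k f Y)
    (S : Finset ι) (σ : ι → ℕ) (A : ι → Finset (Fin n)) (v : Fin n → Fin k → F)
    (hv : ∀ j, v j ∈ Y) (j : Fin n)
    (h : Ind S (fun i => if j ∈ A i then σ i + 1 else σ i) (fun i => (A i).erase j) v) :
    ∃ w : Fin n → Fin k → F, (∀ j, w j ∈ Y) ∧ Ind S σ A w := by
  obtain ⟨O, hF, ρ, hρ, hρF, hf0, hfv⟩ := H.hplace
  have := merge_generic O hF ρ hρ hρF f hf0 hfv S σ A v j h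
  obtain ⟨P, hP, hP'⟩ := Ind_open (F := F) S σ A _ this
  rw [← aeval_substP, H.hgen] at hP
  obtain ⟨y, hy, hyP⟩ := hP
  rw [eval_substP] at hyP
  refine ⟨Function.update v j y, fun i => ?_, hP' _ hyP⟩
  by_cases h : i = j
  · subst h; simpa using hy
  · simpa [h] using hv i

theorem Setup.both {ι F K : Type*} [Fintype ι] [Field F] [Field K] [Algebra F K] {k n : ℕ}
    {f : Fin k → K} {Y : Set (Fin k → F)} (H : Setup F K k f Y)
    (S S' : Finset ι) (σ σ' : ι → ℕ) (A A' : ι → Finset (Fin n))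
    (h : ∃ w : Fin n → Fin k → F, (∀ j, w j ∈ Y) ∧ Ind S σ A w)
    (h' : ∃ w : Fin n → Fin k → F, (∀ j, w j ∈ Y) ∧ Ind S' σ' A' w) :
    ∃ w : Fin n → Fin k → F, (∀ j, w j ∈ Y) ∧ Ind S σ A w ∧ Ind S' σ' A' w := by
  obtain ⟨v, hv, hi⟩ := h
  obtain ⟨w, hw, hi'⟩ := h'
  obtain ⟨P, hP, hP'⟩ := Ind_open (F := F) S σ A _ hi
  obtain ⟨Q, hQ, hQ'⟩ := Ind_open (F := F) S' σ' A' _ hi'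
  rw [MvPolynomial.aeval_eq_eval] at hP hQ
  obtain ⟨u, hu, h1, h2⟩ := irred_prod f Y H.hgen P Q v w hv hw hP hQ
  exact ⟨u, hu, hP' u h1, hQ' u h2⟩

/-- Finitely many nonempty conditions hold simultaneously. -/
theorem Setup.all {ι F K τ : Type*} [Fintype ι] [Field F] [Field K] [Algebra F K] {k n : ℕ}
    {f : Fin k → K} {Y : Set (Fin k → F)} (H : Setup F K k f Y) (hY : Y.Nonempty)
    (T : Finset τ) (S : τ → Finset ι) (σ : τ → ι → ℕ) (A : τ → ι → Finset (Fin n))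
    (h : ∀ a ∈ T, ∃ w : Fin n → Fin k → F, (∀ j, w j ∈ Y) ∧ Ind (S a) (σ a) (A a) w) :
    ∃ w : Fin n → Fin k → F, (∀ j, w j ∈ Y) ∧ ∀ a ∈ T, Ind (S a) (σ a) (A a) w := by
  classical
  choose! w hw hi using h
  have h2 : ∀ a ∈ T, ∃ P : MvPolynomial (Fin n × Fin k) F,
      MvPolynomial.eval (fun p => w a p.1 p.2) P ≠ 0 ∧ ∀ v' : Fin n → Fin k → F,
        MvPolynomial.eval (fun p => v' p.1 p.2) P ≠ 0 → Ind (S a) (σ a) (A a) v' := by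
    intro a ha
    obtain ⟨P, hP, hP'⟩ := Ind_open (F := F) _ _ _ _ (hi a ha)
    rw [MvPolynomial.aeval_eq_eval] at hP
    exact ⟨P, hP, hP'⟩
  choose! P hP hP' using h2
  have key : ∀ s ⊆ T, ∃ u : Fin n → Fin k → F, (∀ j, u j ∈ Y) ∧
      MvPolynomial.eval (fun p => u p.1 p.2) (∏ a ∈ s, P a) ≠ 0 := by
    intro s
    induction s using Finset.induction_on with
    | empty =>
      intro _
      obtain ⟨y, hy⟩ := hY
      exact ⟨fun _ => y, fun _ => hy, by simp⟩
    | insert a s ha ih =>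
      intro hs
      obtain ⟨u, hu, hu'⟩ := ih (fun x hx => hs (Finset.mem_insert_of_mem hx))
      have haT := hs (Finset.mem_insert_self a s)
      obtain ⟨z, hz, h1, h2⟩ := irred_prod f Y H.hgen _ _ _ _ (hw a haT) hu (hP a haT) hu'
      refine ⟨z, hz, ?_⟩
      rw [Finset.prod_insert ha, map_mul]
      exact mul_ne_zero h1 h2
  obtain ⟨u, hu, hu'⟩ := key T subset_rfl
  refine ⟨u, hu, fun a ha => hP' a ha u ?_⟩
  rw [map_prod, Finset.prod_ne_zero_iff] at hu'
  exact hu' a ha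

/-- The combinatorial condition. -/
def VS {ι : Type*} {n : ℕ} (k : ℕ) (S : Finset ι) (σ : ι → ℕ) (A : ι → Finset (Fin n)) : Prop :=
  (∀ i ∈ S, (A i).card + σ i ≤ k) ∧
  ∀ I ⊆ S, I.Nonempty → ∀ (T : Finset (Fin n)) (s : ℕ), (∀ i ∈ I, T ⊆ A i) → (∀ i ∈ I, s ≤ σ i) →
    ∑ i ∈ I, (k - ((A i).card + σ i)) + T.card + s ≤ k

theorem Setup.full {ι F K : Type*} [Fintype ι] [DecidableEq ι] [Field F] [Field K] [Algebra F K]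
    {k n : ℕ} {f : Fin k → K} {Y : Set (Fin k → F)} (H : Setup F K k f Y) (hY : Y.Nonempty)
    (i i' : ι) (hii : i ≠ i') (A0 : Finset (Fin n)) :
    ∀ σ0 : ℕ, A0.card + σ0 = k →
    ∃ w : Fin n → Fin k → F, (∀ j, w j ∈ Y) ∧
      Ind {i, i'} (fun l => if l = i then σ0 else 0) (fun l => if l = i then A0 else ∅) w := by
  induction A0 using Finset.induction_on with
  | empty =>
    intro σ0 h0
    obtain ⟨y, hy⟩ := hY
    refine ⟨fun _ => y, fun _ => hy, ?_⟩
    intro u h1 _ h3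
    have hui : u i = 0 := by
      ext t
      apply h1 i (by simp) t
      have := t.2
      simp only [Finset.card_empty] at h0
      simp only [if_true]
      omega
    have hui' : u i' = 0 := by
      ext t
      have := h3 t
      rw [Finset.sum_pair hii, hui] at this
      simpa using this
    intro l hl
    rcases Finset.mem_insert.1 hl with rfl | hl
    · exact hui
    · rw [Finset.mem_singleton.1 hl]; exact hui'
  | insert j A hj ih =>
    intro σ0 h0
    rw [Finset.card_insert_of_notMem hj] at h0
    obtain ⟨v, hv, hi⟩ := ih (σ0 + 1) (by omega)
    apply H.merge _ _ _ v hv j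
    convert hi using 1
    · ext l
      by_cases hl : l = i <;> simp [hl]
    · ext l
      by_cases hl : l = i <;> simp [hl, Finset.erase_insert hj]

theorem ind_tight {ι F : Type*} [DecidableEq ι] [Field F] {k n : ℕ}
    (S I : Finset ι) (hIS : I ⊆ S) (i1 : ι) (hi1 : i1 ∈ I)
    (σ : ι → ℕ) (A : ι → Finset (Fin n)) (T : Finset (Fin n)) (s : ℕ)
    (hT : ∀ i ∈ I, T ⊆ A i) (hs : ∀ i ∈ I, s ≤ σ i) (w : Fin n → Fin k → F)
    (h1 : Ind I σ A w)
    (h2 : Ind (insert i1 (S \ I)) (Function.update σ i1 s) (Function.update A i1 T) w) :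
    Ind S σ A w := by
  intro u e1 e2 e3
  have hi1n : i1 ∉ S \ I := by simp [hi1]
  have hne : ∀ i ∈ S \ I, i ≠ i1 := fun i hi h => hi1n (h ▸ hi)
  have hsum : ∀ t, ∑ i ∈ I, u i t + ∑ i ∈ S \ I, u i t = 0 := by
    intro t
    rw [← e3 t, add_comm, Finset.sum_sdiff hIS]
  have key := h2 (Function.update u i1 (fun t => ∑ i ∈ I, u i t)) ?_ ?_ ?_
  · have hI : ∀ i ∈ I, u i = 0 := by
      refine h1 u (fun i hi => e1 i (hIS hi)) (fun i hi => e2 i (hIS hi)) (fun t => ?_)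
      have := congrFun (key i1 (Finset.mem_insert_self _ _)) t
      simpa using this
    intro i hi
    by_cases hiI : i ∈ I
    · exact hI i hiI
    · have hm : i ∈ S \ I := by simp [hi, hiI]
      have := key i (Finset.mem_insert_of_mem hm)
      rwa [Function.update_of_ne (hne i hm)] at this
  · intro i hi t ht
    rcases Finset.mem_insert.1 hi with rfl | hi
    · simp only [Function.update_self] at ht ⊢
      exact Finset.sum_eq_zero fun i hi => e1 i (hIS hi) t (ht.trans_le (hs i hi))
    · rw [Function.update_of_ne (hne i hi)] at ht ⊢
      exact e1 i (Finset.mem_sdiff.1 hi).1 t ht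
  · intro i hi j hj
    rcases Finset.mem_insert.1 hi with rfl | hi
    · simp only [Function.update_self] at hj ⊢
      simp only [Finset.mul_sum]
      rw [Finset.sum_comm]
      exact Finset.sum_eq_zero fun i hi => e2 i (hIS hi) j (hT i hi hj)
    · rw [Function.update_of_ne (hne i hi)] at hj ⊢
      exact e2 i (Finset.mem_sdiff.1 hi).1 j hj
  · intro t
    rw [Finset.sum_insert hi1n, Function.update_self, ← hsum t]
    congr 1
    exact Finset.sum_congr rfl fun i hi => by rw [Function.update_of_ne (hne i hi)]

theorem VS.mono {ι : Type*} {n k : ℕ} {S I : Finset ι} {σ : ι → ℕ} {A : ι → Finset (Fin n)}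
    (h : VS k S σ A) (hI : I ⊆ S) : VS k I σ A :=
  ⟨fun i hi => h.1 i (hI hi), fun J hJ => h.2 J (hJ.trans hI)⟩

theorem VS.tight {ι : Type*} [DecidableEq ι] {n k : ℕ} {S I : Finset ι} {σ : ι → ℕ}
    {A : ι → Finset (Fin n)} (h : VS k S σ A) (hIS : I ⊆ S) (i1 : ι) (hi1 : i1 ∈ I)
    (T : Finset (Fin n)) (s : ℕ) (hT : ∀ i ∈ I, T ⊆ A i) (hs : ∀ i ∈ I, s ≤ σ i)
    (htight : k ≤ ∑ i ∈ I, (k - ((A i).card + σ i)) + T.card + s) :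
    VS k (insert i1 (S \ I)) (Function.update σ i1 s) (Function.update A i1 T) := by
  have hle := h.2 I hIS ⟨i1, hi1⟩ T s hT hs
  have hi1n : i1 ∉ S \ I := by simp [hi1]
  have hne : ∀ i ∈ S \ I, i ≠ i1 := fun i hi h => hi1n (h ▸ hi)
  constructor
  · intro i hi
    rcases Finset.mem_insert.1 hi with rfl | hi
    · simp only [Function.update_self]; omega
    · rw [Function.update_of_ne (hne i hi), Function.update_of_ne (hne i hi)]
      exact h.1 i (Finset.mem_sdiff.1 hi).1
  · intro J hJ hJne T' s' hT' hs'
    have hcongr : ∀ J' ⊆ S \ I, ∑ i ∈ J', (k - ((Function.update A i1 T i).card +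
        Function.update σ i1 s i)) = ∑ i ∈ J', (k - ((A i).card + σ i)) := by
      intro J' hJ'
      refine Finset.sum_congr rfl fun i hi => ?_
      rw [Function.update_of_ne (hne i (hJ' hi)), Function.update_of_ne (hne i (hJ' hi))]
    by_cases hm : i1 ∈ J
    · have hJe : J.erase i1 ⊆ S \ I := by
        intro i hi
        exact Finset.mem_of_mem_insert_of_ne (hJ (Finset.mem_of_mem_erase hi))
          (Finset.ne_of_mem_erase hi)
      have hT1 := hT' i1 hm
      have hs1 := hs' i1 hm
      simp only [Function.update_self] at hT1 hs1
      rw [← Finset.add_sum_erase _ _ hm, hcongr _ hJe]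
      simp only [Function.update_self]
      have hdisj : Disjoint I (J.erase i1) :=
        Finset.disjoint_of_subset_right hJe Finset.disjoint_sdiff
      have := h.2 (I ∪ J.erase i1) (Finset.union_subset hIS (hJe.trans Finset.sdiff_subset))
        ⟨i1, by simp [hi1]⟩ T' s' ?_ ?_
      · rw [Finset.sum_union hdisj] at this
        omega
      · intro i hi
        rcases Finset.mem_union.1 hi with hi | hi
        · exact hT1.trans (hT i hi)
        · have := hT' i (Finset.mem_of_mem_erase hi)
          rwa [Function.update_of_ne (Finset.ne_of_mem_erase hi)] at this
      · intro i hi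
        rcases Finset.mem_union.1 hi with hi | hi
        · exact hs1.trans (hs i hi)
        · have := hs' i (Finset.mem_of_mem_erase hi)
          rwa [Function.update_of_ne (Finset.ne_of_mem_erase hi)] at this
    · have hJs : J ⊆ S \ I := by
        intro i hi
        exact Finset.mem_of_mem_insert_of_ne (hJ hi) (fun h => hm (h ▸ hi))
      rw [hcongr J hJs]
      apply h.2 J (hJs.trans Finset.sdiff_subset) hJne
      · intro i hi
        have := hT' i hi
        rwa [Function.update_of_ne (hne i (hJs hi))] at this
      · intro i hi
        have := hs' i hi
        rwa [Function.update_of_ne (hne i (hJs hi))] at this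

theorem VS.merge {ι : Type*} {n k : ℕ} {S : Finset ι} {σ : ι → ℕ}
    {A : ι → Finset (Fin n)} (h : VS k S σ A)
    (hnt : ∀ I ⊆ S, I ≠ S → 1 < I.card → ∀ (T : Finset (Fin n)) (s : ℕ), (∀ i ∈ I, T ⊆ A i) →
      (∀ i ∈ I, s ≤ σ i) → ∑ i ∈ I, (k - ((A i).card + σ i)) + T.card + s < k)
    (j : Fin n) (i0 : ι) (hi0 : i0 ∈ S) (hmin : ∀ i ∈ S, σ i0 ≤ σ i) (hj : j ∉ A i0) :
    VS k S (fun i => if j ∈ A i then σ i + 1 else σ i) (fun i => (A i).erase j) := by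
  have hcard : ∀ i, ((A i).erase j).card + (if j ∈ A i then σ i + 1 else σ i)
      = (A i).card + σ i := by
    intro i
    split_ifs with hji
    · have := Finset.card_erase_add_one hji
      omega
    · rw [Finset.erase_eq_of_notMem hji]
  constructor
  · intro i hi
    rw [hcard]; exact h.1 i hi
  · intro I hI hIne T s hT hs
    beta_reduce at hT hs
    simp only [hcard]
    have hT' : ∀ i ∈ I, T ⊆ A i := fun i hi => (hT i hi).trans (Finset.erase_subset _ _)
    by_cases hIS : I = S
    · subst hIS
      refine h.2 I hI hIne T s hT' fun i hi => ?_
      have := hs i0 hi0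
      rw [if_neg hj] at this
      exact this.trans (hmin i hi)
    · by_cases hc : 1 < I.card
      · have := hnt I hI hIS hc T (s - 1) hT' (fun i hi => by
          have := hs i hi
          split_ifs at this <;> omega)
        omega
      · have hc1 : I.card = 1 := by
          have := hIne.card_pos
          omega
        obtain ⟨i, rfl⟩ := Finset.card_eq_one.1 hc1
        have h1 := Finset.card_le_card (hT i (by simp))
        have h2 := hs i (by simp)
        have h3 := hcard i
        have h4 := h.1 i (hI (by simp))
        rw [Finset.sum_singleton]
        omega

theorem Setup.main {ι F K : Type*} [Fintype ι] [Field F] [Field K] [Algebra F K]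
    {k n : ℕ} {f : Fin k → K} {Y : Set (Fin k → F)} (H : Setup F K k f Y) (hY : Y.Nonempty)
    (N : ℕ) : ∀ (M : ℕ) (S : Finset ι) (σ : ι → ℕ) (A : ι → Finset (Fin n)), S.card = N →
      ∑ i ∈ S, (k - σ i) = M → VS k S σ A →
      ∃ w : Fin n → Fin k → F, (∀ j, w j ∈ Y) ∧ Ind S σ A w := by
  classical
  induction N using Nat.strong_induction_on with
  | _ N ihN =>
  intro M
  induction M using Nat.strong_induction_on with
  | _ M ihM =>
  intro S σ A hN hM hV
  by_cases hS1 : S.card ≤ 1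
  · -- at most one member
    obtain ⟨y, hy⟩ := hY
    refine ⟨fun _ => y, fun _ => hy, ?_⟩
    intro u _ _ h3 i hi
    have hSi : S = {i} := by
      apply Finset.eq_singleton_iff_unique_mem.2 ⟨hi, fun x hx => Finset.card_le_one.1 hS1 x hx i hi⟩
    ext t
    have := h3 t
    rw [hSi, Finset.sum_singleton] at this
    exact this
  push Not at hS1
  by_cases hfull : ∃ i ∈ S, (A i).card + σ i = k
  · -- a full member
    obtain ⟨i, hi, hik⟩ := hfull
    obtain ⟨i', hi', hne⟩ := Finset.exists_mem_ne hS1 i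
    have h1 := ihN (S.erase i).card (by rw [← hN]; exact Finset.card_erase_lt_of_mem hi) _
      (S.erase i) σ A rfl rfl (hV.mono (Finset.erase_subset _ _))
    have h2 := H.full hY i i' hne.symm (A i) (σ i) hik
    obtain ⟨w, hw, hI1, hI2⟩ := H.both _ _ _ _ _ _ h1 h2
    refine ⟨w, hw, ?_⟩
    intro u e1 e2 e3
    have hui : u i = 0 := by
      have := hI2 (fun l => if l = i then u i else -u i) ?_ ?_ ?_ i (by simp)
      · simpa using this
      · intro l hl t ht
        by_cases hli : l = i
        · subst hli
          simp only [if_true] at ht ⊢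
          exact e1 l hi t ht
        · simp [hli] at ht
      · intro l hl j hj
        by_cases hli : l = i
        · subst hli
          simp only [if_true] at hj ⊢
          exact e2 l hi j hj
        · simp [hli] at hj
      · intro t
        rw [Finset.sum_pair hne.symm]
        simp [hne]
    have hrest := hI1 u (fun l hl => e1 l (Finset.mem_of_mem_erase hl))
      (fun l hl => e2 l (Finset.mem_of_mem_erase hl)) (fun t => by
        have := e3 t
        rw [← Finset.add_sum_erase _ _ hi, hui] at this
        simpa using this)
    intro l hl
    by_cases hli : l = i
    · rw [hli, hui]
    · exact hrest l (Finset.mem_erase.2 ⟨hli, hl⟩)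
  push Not at hfull
  by_cases htight : ∃ I ⊆ S, I ≠ S ∧ 1 < I.card ∧ ∃ (T : Finset (Fin n)) (s : ℕ),
      (∀ i ∈ I, T ⊆ A i) ∧ (∀ i ∈ I, s ≤ σ i) ∧
      k ≤ ∑ i ∈ I, (k - ((A i).card + σ i)) + T.card + s
  · -- a tight proper subfamily
    obtain ⟨I, hIS, hIne, hIc, T, s, hT, hs, hk⟩ := htight
    obtain ⟨i1, hi1⟩ : I.Nonempty := Finset.card_pos.1 (by omega)
    have hlt : I.card < S.card := Finset.card_lt_card (hIS.ssubset_of_ne hIne)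
    have h1 := ihN I.card (by omega) _ I σ A rfl rfl (hV.mono hIS)
    have h2 := ihN (insert i1 (S \ I)).card (by
      have h3 := Finset.card_insert_le i1 (S \ I)
      have h4 := Finset.card_sdiff_add_card_eq_card hIS
      omega) _ _ _ _ rfl rfl (hV.tight hIS i1 hi1 T s hT hs hk)
    obtain ⟨w, hw, hI1, hI2⟩ := H.both _ _ _ _ _ _ h1 h2
    exact ⟨w, hw, ind_tight S I hIS i1 hi1 σ A T s hT hs w hI1 hI2⟩
  push Not at htight
  obtain ⟨i0, hi0, hmin⟩ := S.exists_min_image σ (Finset.card_pos.1 (by omega))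
  by_cases hmerge : ∃ j, (∃ i ∈ S, j ∈ A i) ∧ ∃ i ∈ S, σ i = σ i0 ∧ j ∉ A i
  · -- merge a point into the flag
    obtain ⟨j, ⟨i2, hi2, hj2⟩, i3, hi3, hσ3, hj3⟩ := hmerge
    have hV' := hV.merge htight j i3 hi3 (fun i hi => by rw [hσ3]; exact hmin i hi) hj3
    obtain ⟨v, hv, hvI⟩ := ihM (∑ i ∈ S, (k - (if j ∈ A i then σ i + 1 else σ i))) (by
      rw [← hM]
      apply Finset.sum_lt_sum
      · intro i _
        split_ifs <;> omega
      · refine ⟨i2, hi2, ?_⟩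
        rw [if_pos hj2]
        have h1 := hV.1 i2 hi2
        have h2 := Finset.card_pos.2 ⟨j, hj2⟩
        omega) S _ _ hN rfl hV'
    exact H.merge S σ A v hv j hvI
  push Not at hmerge
  have hlt : ∀ i ∈ S, i ≠ i0 → σ i0 < σ i := by
    intro i hi hne
    by_contra hcon
    have heq : σ i = σ i0 := le_antisymm (not_lt.1 hcon) (hmin i hi)
    have hAA : A i0 = A i := by
      ext j
      exact ⟨fun hj => hmerge j ⟨i0, hi0, hj⟩ i hi heq, fun hj => hmerge j ⟨i, hi, hj⟩ i0 hi0 rfl⟩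
    have h1 := hV.2 {i, i0} (by
      intro x hx
      rcases Finset.mem_insert.1 hx with rfl | hx
      · exact hi
      · rw [Finset.mem_singleton.1 hx]; exact hi0) ⟨i, by simp⟩ (A i0) (σ i0)
      (by simp [hAA]) (by simp [heq])
    rw [Finset.sum_pair hne, heq, ← hAA] at h1
    have h2 := hV.1 i0 hi0
    have h3 := hfull i0 hi0
    omega
  -- raise the unique minimal multiplicity
  have hd0 : (A i0).card + σ i0 < k := lt_of_le_of_ne (hV.1 i0 hi0) (hfull i0 hi0)
  have hV' : VS k S (Function.update σ i0 (σ i0 + 1)) A := by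
    constructor
    · intro i hi
      by_cases hii : i = i0
      · subst hii; simp only [Function.update_self]; omega
      · rw [Function.update_of_ne hii]; exact hV.1 i hi
    · intro I hI hIne T s hT hs
      by_cases hm : i0 ∈ I
      · have hs0 := hs i0 hm
        simp only [Function.update_self] at hs0
        have := hV.2 I hI hIne T (s - 1) hT (fun i hi => by
          have := hmin i (hI hi)
          omega)
        rw [← Finset.add_sum_erase _ _ hm] at this ⊢
        simp only [Function.update_self]
        have hc : ∑ i ∈ I.erase i0, (k - ((A i).card + Function.update σ i0 (σ i0 + 1) i)) =
            ∑ i ∈ I.erase i0, (k - ((A i).card + σ i)) :=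
          Finset.sum_congr rfl fun i hi => by
            rw [Function.update_of_ne (Finset.ne_of_mem_erase hi)]
        rw [hc]
        omega
      · have hne : ∀ i ∈ I, i ≠ i0 := fun i hi h => hm (h ▸ hi)
        have hc : ∑ i ∈ I, (k - ((A i).card + Function.update σ i0 (σ i0 + 1) i)) =
            ∑ i ∈ I, (k - ((A i).card + σ i)) :=
          Finset.sum_congr rfl fun i hi => by
            rw [Function.update_of_ne (hne i hi)]
        rw [hc]
        refine hV.2 I hI hIne T s hT fun i hi => ?_
        have := hs i hi
        rwa [Function.update_of_ne (hne i hi)] at this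
  obtain ⟨w, hw, hwI⟩ := ihM (∑ i ∈ S, (k - Function.update σ i0 (σ i0 + 1) i)) (by
    rw [← hM]
    apply Finset.sum_lt_sum
    · intro i _
      by_cases hii : i = i0
      · subst hii; simp only [Function.update_self]; omega
      · rw [Function.update_of_ne hii]
    · refine ⟨i0, hi0, ?_⟩
      simp only [Function.update_self]
      omega) S _ _ hN rfl hV'
  refine ⟨w, hw, ?_⟩
  intro u e1 e2 e3
  refine hwI u ?_ e2 e3
  intro i hi t ht
  by_cases hii : i = i0
  · subst hii
    simp only [Function.update_self] at ht
    have := e3 t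
    rw [← Finset.add_sum_erase _ _ hi, Finset.sum_eq_zero (fun l hl => ?_), add_zero] at this
    · exact this
    · have hl' := Finset.mem_erase.1 hl
      have := hlt l hl'.2 hl'.1
      exact e1 l hl'.2 t (by omega)
  · rw [Function.update_of_ne hii] at ht
    exact e1 i hi t ht

theorem VS_of_nullInter {ℓ n k : ℕ} (A : Fin ℓ → Finset (Fin n)) (h1 : ∀ i, (A i).card ≤ k)
    (h2 : ∑ i, (A i).card = (ℓ - 1) * k) (h3 : NullInter k A) (hℓ : 2 ≤ ℓ) :
    VS k Finset.univ (fun _ => 0) A := by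
  classical
  refine ⟨fun i _ => by simpa using h1 i, ?_⟩
  intro J _ hJne T s hT hs
  obtain ⟨j0, hj0⟩ := hJne
  have hs0 : s = 0 := by
    have := hs j0 hj0
    simpa using this
  have hJne : J ≠ ⊥ := fun h => by simp [h] at hj0
  have hdis : Disjoint (Finset.univ \ J) J := Finset.sdiff_disjoint
  have hsup : (Finset.univ \ J) ⊔ J = Finset.univ := by simp
  have h4 := h3 ((⊥ : Finpartition (Finset.univ \ J)).extend hJne hdis hsup)
  rw [Finpartition.card_extend, Finpartition.card_bot, Nat.add_sub_cancel] at h4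
  have hnot : J ∉ (⊥ : Finpartition (Finset.univ \ J)).parts := by
    intro hm
    have h5 := (⊥ : Finpartition (Finset.univ \ J)).le hm
    have := h5 hj0
    simp [hj0] at this
  rw [Finpartition.extend_parts, Finset.sum_insert hnot, Finpartition.parts_bot,
    Finset.sum_map] at h4
  have hsing : ∀ i : Fin ℓ, interSet A {i} = A i := by
    intro i
    ext x
    simp [interSet]
  simp only [Function.Embedding.coeFn_mk, hsing] at h4
  have hTc : T.card ≤ (interSet A J).card := by
    apply Finset.card_le_card
    intro x hx
    simp only [interSet, Finset.mem_filter, Finset.mem_univ, true_and]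
    exact fun j hj => hT j hj hx
  have hsum : ∑ i ∈ Finset.univ \ J, (A i).card + ∑ i ∈ J, (A i).card = (ℓ - 1) * k := by
    rw [Finset.sum_sdiff (Finset.subset_univ J), h2]
  have hcard : (Finset.univ \ J).card + J.card = ℓ := by
    rw [Finset.card_sdiff_add_card_eq_card (Finset.subset_univ J)]; simp
  have hkk : ∑ i ∈ J, (k - ((A i).card + 0)) + ∑ i ∈ J, (A i).card = J.card * k := by
    rw [← Finset.sum_add_distrib, Finset.sum_congr rfl (g := fun _ => k)]
    · simp
    · intro i _
      have := h1 i
      omega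
  have e1 : (ℓ - 1) * k + k = ℓ * k := by
    obtain ⟨m, rfl⟩ : ∃ m, ℓ = m + 1 := ⟨ℓ - 1, by omega⟩
    simp; ring
  have e2 : (Finset.univ \ J).card * k + J.card * k = ℓ * k := by rw [← add_mul, hcard]
  beta_reduce
  omega

theorem inf_span_of_ind {F : Type*} [Field F] {ℓ n k : ℕ} (A : Fin ℓ → Finset (Fin n))
    (w : Fin n → Fin k → F) (h1 : ∀ i, (A i).card ≤ k)
    (h2 : ∑ i, (A i).card = (ℓ - 1) * k) (hℓ : 2 ≤ ℓ)
    (hI : Ind Finset.univ (fun _ => 0) A w) (z : Fin k → F)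
    (hz : ∀ i, z ∈ Submodule.span F (w '' (A i : Set (Fin n)))) : z = 0 := by
  classical
  let g : ∀ i, (Fin k → F) →ₗ[F] (A i → F) := fun i =>
    Matrix.mulVecLin (Matrix.of fun (j : A i) (t : Fin k) => w j t)
  have hg : ∀ i u, u ∈ LinearMap.ker (g i) ↔ ∀ j ∈ A i, ∑ t, w j t * u t = 0 := by
    intro i u
    rw [LinearMap.mem_ker, funext_iff]
    simp [g, Matrix.mulVec, dotProduct]
  have hdim : ∀ i, k - (A i).card ≤ Module.finrank F (LinearMap.ker (g i)) := by
    intro i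
    have e1 := LinearMap.finrank_range_add_finrank_ker (g i)
    have e2 := Submodule.finrank_le (LinearMap.range (g i))
    simp only [Module.finrank_fintype_fun_eq_card, Fintype.card_fin, Fintype.card_coe] at e1 e2
    omega
  let Ψ : (∀ i, LinearMap.ker (g i)) →ₗ[F] (Fin k → F) :=
    ∑ i, (LinearMap.ker (g i)).subtype ∘ₗ LinearMap.proj i
  have hΨ : ∀ u, Ψ u = ∑ i, (u i : Fin k → F) := by
    intro u; simp [Ψ]
  have hinj : Function.Injective Ψ := by
    rw [← LinearMap.ker_eq_bot, LinearMap.ker_eq_bot']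
    intro u hu
    rw [hΨ] at hu
    have := hI (fun i => (u i : Fin k → F)) (by simp)
      (fun i _ => (hg i _).1 (u i).2) (fun t => by
        have := congrFun hu t
        simpa using this)
    ext i : 2
    exact this i (Finset.mem_univ i)
  have hfr : Module.finrank F (∀ i, LinearMap.ker (g i)) = Module.finrank F (Fin k → F) := by
    apply le_antisymm (LinearMap.finrank_le_finrank_of_injective hinj)
    rw [Module.finrank_fintype_fun_eq_card, Fintype.card_fin, Module.finrank_pi_fintype]
    have e3 := Finset.sum_le_sum (fun i (_ : i ∈ Finset.univ) => hdim i)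
    have e4 : ∑ i, (k - (A i).card) + ∑ i, (A i).card = ℓ * k := by
      rw [← Finset.sum_add_distrib, Finset.sum_congr rfl (g := fun _ => k)]
      · simp
      · intro i _
        have := h1 i
        omega
    have e1 : (ℓ - 1) * k + k = ℓ * k := by
      obtain ⟨m, rfl⟩ : ∃ m, ℓ = m + 1 := ⟨ℓ - 1, by omega⟩
      simp; ring
    omega
  have hsurj := (LinearMap.injective_iff_surjective_of_finrank_eq_finrank hfr).1 hinj
  have horth : ∀ i, ∀ u ∈ LinearMap.ker (g i), z ⬝ᵥ u = 0 := by
    intro i u hu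
    rw [hg] at hu
    have hzi := hz i
    clear hz
    induction hzi using Submodule.span_induction with
    | mem x hx =>
      obtain ⟨j, hj, rfl⟩ := hx
      exact hu j hj
    | zero => simp
    | add x y _ _ hx hy => rw [add_dotProduct, hx, hy, add_zero]
    | smul a x _ hx => rw [smul_dotProduct, hx, smul_zero]
  ext t
  obtain ⟨u, hu⟩ := hsurj (Pi.single t 1)
  rw [hΨ] at hu
  have : z ⬝ᵥ Pi.single t 1 = 0 := by
    rw [← hu, dotProduct_sum]
    exact Finset.sum_eq_zero fun i _ => horth i _ (u i).2
  simpa using this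

theorem exists_setup (F : Type*) [Field F] [IsAlgClosed F] (k : ℕ)
    (I : Ideal (MvPolynomial (Fin k) F)) (hI : I.IsPrime)
    (X : Set (Fin k → F))
    (hX : X = {x : Fin k → F | ∀ g ∈ I, MvPolynomial.eval x g = 0})
    (hMDS : ∀ c : Fin k → F, c ≠ 0 → ∃ x ∈ X, (∑ t, c t * x t) ≠ 0) :
    ∃ (f : Fin k → FractionRing (MvPolynomial (Fin k) F ⧸ I)) (B : Matrix (Fin k) (Fin k) F),
      Function.Injective B.mulVec ∧ Setup F (FractionRing (MvPolynomial (Fin k) F ⧸ I)) k f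
        ((fun v => B.mulVec v) '' X) := by
  set R := MvPolynomial (Fin k) F ⧸ I with hR
  set K := FractionRing R with hK
  let x : Fin k → K := fun t => algebraMap R K (Ideal.Quotient.mk I (MvPolynomial.X t))
  have hae : ∀ p, MvPolynomial.aeval x p = algebraMap R K (Ideal.Quotient.mk I p) := by
    intro p
    have : MvPolynomial.aeval x =
        (IsScalarTower.toAlgHom F R K).comp (Ideal.Quotient.mkₐ F I) := by
      ext t
      simp [x]
      rfl
    rw [this]; rfl
  have hae0 : ∀ p, MvPolynomial.aeval x p = 0 ↔ p ∈ I := by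
    intro p
    rw [hae, FaithfulSMul.algebraMap_eq_zero_iff, Ideal.Quotient.eq_zero_iff_mem]
  have hnull : ∀ p, p ∉ I ↔ ∃ y ∈ X, MvPolynomial.eval y p ≠ 0 := by
    intro p
    rw [← not_iff_not]
    push Not
    conv_lhs => rw [← MvPolynomial.IsPrime.vanishingIdeal_zeroLocus (k := F) (K := F) I]
    rw [MvPolynomial.mem_vanishingIdeal_iff]
    subst hX
    simp [MvPolynomial.mem_zeroLocus_iff, MvPolynomial.aeval_eq_eval]
  have hli : LinearIndependent F x := by
    rw [Fintype.linearIndependent_iff]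
    intro c hc
    by_contra hne
    have hc0 : c ≠ 0 := fun h => hne (by simp [h])
    obtain ⟨y, hy, hyne⟩ := hMDS c hc0
    have : (∑ t, MvPolynomial.C (c t) * MvPolynomial.X t : MvPolynomial (Fin k) F) ∉ I :=
      (hnull _).2 ⟨y, hy, by simpa using hyne⟩
    rw [← hae0] at this
    apply this
    rw [← hc]
    simp [Algebra.smul_def]
  obtain ⟨O, hF, hres⟩ := exists_closed_valuation F K
  obtain ⟨ρ, hρ1, hρ2⟩ := exists_place O hF hres
  obtain ⟨f, hfL, hfv, hf0, hfli⟩ := exists_flag_basis O hF hres k (Submodule.span F (Set.range x))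
    (FiniteDimensional.span_of_finite F (Set.finite_range x)) (by rw [finrank_span_eq_card hli]; simp)
  have hB : ∀ j, ∃ c : Fin k → F, ∑ t, c t • x t = f j := fun j =>
    (Submodule.mem_span_range_iff_exists_fun F).1 (hfL j)
  choose B hB using hB
  refine ⟨f, Matrix.of B, ?_, ?_⟩
  · rw [Matrix.mulVec_injective_iff_isUnit, ← Matrix.linearIndependent_rows_iff_isUnit]
    rw [Fintype.linearIndependent_iff] at hfli ⊢
    intro g hg
    apply hfli
    simp only [← hB, Finset.smul_sum, smul_smul]
    rw [Finset.sum_comm]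
    simp only [← Finset.sum_smul]
    apply Finset.sum_eq_zero
    intro t _
    have := congrFun hg t
    simp [Matrix.row] at this
    rw [this, zero_smul]
  · refine ⟨?_, O, hF, ρ, hρ1, hρ2, hf0, hfv⟩
    intro p
    let q : MvPolynomial (Fin k) F := MvPolynomial.bind₁
      (fun j => ∑ t, MvPolynomial.C (B j t) * MvPolynomial.X t) p
    have hq1 : MvPolynomial.aeval f p = MvPolynomial.aeval x q := by
      simp only [q, MvPolynomial.aeval_bind₁]
      congr 2
      ext j
      rw [← hB]
      simp [Algebra.smul_def]
    have hq2 : ∀ y, MvPolynomial.eval y q =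
        MvPolynomial.eval ((Matrix.of B).mulVec y) p := by
      intro y
      simp only [q, ← MvPolynomial.coe_aeval_eq_eval, RingHom.coe_coe, MvPolynomial.aeval_bind₁]
      congr 2
      ext j
      simp [Matrix.mulVec, dotProduct]
    rw [hq1, Ne, hae0, hnull]
    simp [hq2]

/-- An irreducible MDS variety is `MDS(ℓ)` for all `ℓ ≥ 2`: if the zero locus `X` of a
prime ideal is not contained in any hyperplane through the origin, then for all `n, ℓ`
there are points of `X` forming a higher order MDS code. -/
theorem irreducible_MDS_variety_is_MDS_ell
    (F : Type*) [Field F] [IsAlgClosed F] (k : ℕ) (hk : 1 ≤ k)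
    (I : Ideal (MvPolynomial (Fin k) F)) (hI : I.IsPrime)
    (X : Set (Fin k → F))
    (hX : X = {x : Fin k → F | ∀ g ∈ I, MvPolynomial.eval x g = 0})
    (hMDS : ∀ c : Fin k → F, c ≠ 0 → ∃ x ∈ X, (∑ t, c t * x t) ≠ 0) :
    ∀ n : ℕ, 1 ≤ n → ∀ ℓ : ℕ, 2 ≤ ℓ →
      ∃ v : Fin n → (Fin k → F), (∀ j, v j ∈ X) ∧
        ∀ A : Fin ℓ → Finset (Fin n),
          (∀ i, (A i).card ≤ k) →
          (∑ i, (A i).card) = (ℓ - 1) * k →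
          NullInter k A →
          (⨅ i, Submodule.span F (v '' (A i : Set (Fin n)))) = ⊥ := by
  classical
  intro n _ ℓ hℓ
  obtain ⟨f, B, hBinj, H⟩ := exists_setup F k I hI X hX hMDS
  have hY : ((fun v => B.mulVec v) '' X).Nonempty := by
    obtain ⟨x, hx, _⟩ := hMDS (fun _ => 1) (fun h => by
      have := congrFun h ⟨0, hk⟩
      simp at this)
    exact ⟨_, x, hx, rfl⟩
  obtain ⟨w, hw, hInd⟩ := H.all hY
    (Finset.univ.filter fun A : Fin ℓ → Finset (Fin n) => (∀ i, (A i).card ≤ k) ∧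
      (∑ i, (A i).card) = (ℓ - 1) * k ∧ NullInter k A)
    (fun _ => Finset.univ) (fun _ _ => 0) (fun A => A) (by
      intro A hA
      simp only [Finset.mem_filter, Finset.mem_univ, true_and] at hA
      exact H.main hY _ _ _ _ _ rfl rfl (VS_of_nullInter A hA.1 hA.2.1 hA.2.2 hℓ))
  choose v hvX hvw using hw
  refine ⟨v, hvX, fun A h1 h2 h3 => ?_⟩
  have hA := hInd A (by simp [h1, h2, h3])
  rw [eq_bot_iff]
  intro z hz
  rw [Submodule.mem_iInf] at hz
  have hBz : B.mulVec z = 0 := by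
    refine inf_span_of_ind A w h1 h2 hℓ hA _ fun i => ?_
    have h4 := Submodule.mem_map_of_mem (f := B.mulVecLin) (hz i)
    rw [Submodule.map_span, ← Set.image_comp] at h4
    have h5 : (B.mulVecLin ∘ v) = w := by
      ext1 j
      exact hvw j
    rwa [h5] at h4
  rw [Submodule.mem_bot]
  apply hBinj
  rw [hBz, Matrix.mulVec_zero]
end
end

section
/- Let F be an algebraically closed field, let 1 ≤ k ≤ n, let I be a prime ideal of F[x_1,…,x_k] = MvPolynomial (Fin k) F, and let X := { x ∈ F^k : g(x) = 0 for all g ∈ I } be its zero locus. Assume that for every nonzero c ∈ F^k there exists x ∈ X with c_1 x_1 + ⋯ + c_k x_k ≠ 0. Then for every ℓ ≥ 2 there exist points v_1, …, v_n ∈ X such that the matrix V ∈ F^{k×n} whose j-th column is v_j has rank k, and every Q ∈ F^{(n−k)×n} of rank n−k with V · Qᵀ = 0 satisfies: for every family A_1, …, A_ℓ of subsets of {1,…,n} with |A_i| ≤ n−k for all i, with |A_1| + ⋯ + |A_ℓ| = (ℓ−1)·(n−k), and having the dimension-(n−k) null intersection property, the intersection over i of the subspaces span_F of the columns of Q indexed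 by A_i is the zero subspace of F^{n−k}. (In other words, an irreducible MDS variety is LD-MDS(≤ L) for all L: duals of codes from generic points of X are higher order MDS.) -/
open Finset Matrix

noncomputable section

lemma aux_val_mul {K : Type*} [Field K] (O : ValuationSubring K) {x y p q : K}
    (hy : O.valuation y ≤ 1) (hp : O.valuation p ≤ 1)
    (h1 : O.valuation (x - p) < 1) (h2 : O.valuation (y - q) < 1) :
    O.valuation (x * y - p * q) < 1 := by
  have : x * y - p * q = (x - p) * y + p * (y - q) := by ring
  rw [this]
  refine Valuation.map_add_lt _ ?_ ?_
  · rw [map_mul]; exact mul_lt_one_of_lt_of_le h1 hy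
  · rw [map_mul, mul_comm]; exact mul_lt_one_of_lt_of_le h2 hp

lemma aux_val_close {K : Type*} [Field K] (O : ValuationSubring K) {x p : K}
    (hp : O.valuation p ≤ 1)
    (h1 : O.valuation (x - p) < 1) : O.valuation x ≤ 1 := by
  have : x = (x - p) + p := by ring
  rw [this]
  exact Valuation.map_add_le _ h1.le hp

/-- The subring of elements congruent to a polynomial in `a` modulo the maximal ideal. -/
def polySubring {F K : Type*} [Field F] [Field K] [Algebra F K] (O : ValuationSubring K)
    (a : K) (hP : ∀ p : Polynomial F, O.valuation (Polynomial.aeval a p) ≤ 1) : Subring K where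
  carrier := {x | ∃ p : Polynomial F, O.valuation (x - Polynomial.aeval a p) < 1}
  mul_mem' := by
    rintro x y ⟨p, hp⟩ ⟨q, hq⟩
    exact ⟨p * q, by rw [map_mul]; exact aux_val_mul O (aux_val_close O (hP q) hq) (hP p) hp hq⟩
  one_mem' := ⟨1, by simp⟩
  add_mem' := by
    rintro x y ⟨p, hp⟩ ⟨q, hq⟩
    refine ⟨p + q, ?_⟩
    rw [map_add, add_sub_add_comm]
    exact Valuation.map_add_lt _ hp hq
  zero_mem' := ⟨0, by simp⟩
  neg_mem' := by
    rintro x ⟨p, hp⟩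
    refine ⟨-p, ?_⟩
    rw [map_neg, ← neg_sub', Valuation.map_neg]
    exact hp

/-- The ideal of elements congruent to a polynomial in `a` without constant term. -/
def polyIdeal {F K : Type*} [Field F] [Field K] [Algebra F K] (O : ValuationSubring K)
    (a : K) (hP : ∀ p : Polynomial F, O.valuation (Polynomial.aeval a p) ≤ 1) :
    Ideal (polySubring O a hP) where
  carrier := {x | ∃ p : Polynomial F,
    O.valuation ((x : K) - Polynomial.aeval a (Polynomial.X * p)) < 1}
  add_mem' := by
    rintro x y ⟨p, hp⟩ ⟨q, hq⟩
    refine ⟨p + q, ?_⟩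
    rw [mul_add, map_add, Subring.coe_add, add_sub_add_comm]
    exact Valuation.map_add_lt _ hp hq
  zero_mem' := ⟨0, by simp⟩
  smul_mem' := by
    rintro ⟨x, p, hp⟩ y ⟨q, hq⟩
    refine ⟨p * q, ?_⟩
    have : (Polynomial.X * (p * q) : Polynomial F) = p * (Polynomial.X * q) := by ring
    rw [this, map_mul]
    exact aux_val_mul O (aux_val_close O (hP _) hq) (hP p) hp hq

lemma exists_good_valuationSubring (F K : Type*) [Field F] [IsAlgClosed F] [Field K]
    [Algebra F K] : ∃ O : ValuationSubring K, (∀ c : F, algebraMap F K c ∈ O) ∧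
      ∀ x ∈ O, ∃ c : F, O.valuation (x - algebraMap F K c) < 1 := by
  obtain ⟨O, -, hO⟩ := zorn_le_nonempty₀ (α := (ValuationSubring K)ᵒᵈ)
    {O | ∀ c : F, algebraMap F K c ∈ OrderDual.ofDual O} (by
      intro C hC hchain Y hY
      refine ⟨OrderDual.toDual (ValuationSubring.ofSubring
        (⨅ O : C, (OrderDual.ofDual O.1).toSubring) ?_), ?_, ?_⟩
      · intro x
        by_contra! h
        obtain ⟨h1, h2⟩ := h
        simp only [Subring.mem_iInf, not_forall, ValuationSubring.mem_toSubring] at h1 h2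
        obtain ⟨⟨O1, hO1⟩, h1⟩ := h1
        obtain ⟨⟨O2, hO2⟩, h2⟩ := h2
        rcases hchain.total hO1 hO2 with h | h
        · have h : OrderDual.ofDual O2 ≤ OrderDual.ofDual O1 := h
          rcases (OrderDual.ofDual O2).mem_or_inv_mem x with h' | h'
          · exact h1 (h h')
          · exact h2 h'
        · have h : OrderDual.ofDual O1 ≤ OrderDual.ofDual O2 := h
          rcases (OrderDual.ofDual O1).mem_or_inv_mem x with h' | h'
          · exact h1 h'
          · exact h2 (h h')
      · intro c
        change algebraMap F K c ∈ (⨅ O : C, (OrderDual.ofDual O.1).toSubring)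
        rw [Subring.mem_iInf]
        rintro ⟨O1, hO1⟩
        exact hC hO1 c
      · intro Z hZ
        change _ ≤ OrderDual.ofDual Z
        intro x hx
        change x ∈ (⨅ O : C, (OrderDual.ofDual O.1).toSubring) at hx
        rw [Subring.mem_iInf] at hx
        exact hx ⟨Z, hZ⟩)
    (OrderDual.toDual ⊤) (fun c => ValuationSubring.mem_top _)
  set P : ValuationSubring K := OrderDual.ofDual O with hPdef
  have hF : ∀ c : F, algebraMap F K c ∈ P := hO.prop
  refine ⟨P, hF, ?_⟩
  by_contra! hcon
  obtain ⟨a, haP, ha⟩ := hcon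
  have hv1 : ∀ c : F, P.valuation (a - algebraMap F K c) = 1 := fun c =>
    le_antisymm ((P.valuation_le_one_iff _).2 (sub_mem haP (hF c))) (ha c)
  have hPoly : ∀ p : Polynomial F, P.valuation (Polynomial.aeval a p) ≤ 1 := by
    intro p
    rw [P.valuation_le_one_iff, Polynomial.aeval_eq_sum_range]
    refine sum_mem fun i _ => ?_
    rw [Algebra.smul_def]
    exact mul_mem (hF _) (pow_mem haP _)
  have hPoly1 : ∀ p : Polynomial F, p ≠ 0 → P.valuation (Polynomial.aeval a p) = 1 := by
    intro p hp
    have hs := (IsAlgClosed.splits p).eq_prod_roots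
    rw [hs, map_mul, Polynomial.aeval_C, map_mul, map_multiset_prod, map_multiset_prod]
    have h1 : P.valuation (algebraMap F K p.leadingCoeff) = 1 := by
      have hne : p.leadingCoeff ≠ 0 := by simpa using hp
      refine le_antisymm ((P.valuation_le_one_iff _).2 (hF _)) ?_
      rw [Valuation.one_le_val_iff _ (by simpa using hp), ← map_inv₀]
      exact (P.valuation_le_one_iff _).2 (hF _)
    rw [h1, one_mul]
    apply Multiset.prod_eq_one
    intro x hx
    simp only [Multiset.mem_map, exists_exists_and_eq_and] at hx
    obtain ⟨r, _, rfl⟩ := hx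
    simpa using hv1 r
  have hne : polyIdeal P a hPoly ≠ ⊤ := by
    rw [Ne, Ideal.eq_top_iff_one]
    rintro ⟨p, hp⟩
    have h1 : ((1 : polySubring P a hPoly) : K) - Polynomial.aeval a (Polynomial.X * p)
      = Polynomial.aeval a (1 - Polynomial.X * p) := by simp
    rw [h1, hPoly1] at hp
    · exact lt_irrefl _ hp
    · intro h
      have := congrArg (Polynomial.eval 0) h
      simp at this
  obtain ⟨B, hB1, hB2⟩ := Ideal.image_subset_nonunits_valuationSubring _ hne
  have hm : ∀ x, P.valuation x < 1 → B.valuation x < 1 := by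
    intro x hx
    refine hB2 ⟨⟨x, 0, by simpa using hx⟩, ⟨0, by simpa using hx⟩, rfl⟩
  have hBP : B ≤ P := by
    intro x hx
    by_contra hxP
    have h2 : x⁻¹ ∈ P.nonunits := P.inv_mem_nonunits_iff.2 (Or.inr hxP)
    have h3 : x⁻¹ ∈ B.nonunits := hm _ h2
    rcases B.inv_mem_nonunits_iff.1 h3 with h | h
    · exact hxP (h ▸ P.zero_mem)
    · exact h hx
  have hBF : ∀ c : F, algebraMap F K c ∈ B := by
    intro c
    refine hB1 ⟨Polynomial.C c, by simp⟩
  have hPB : P ≤ B := hO.le_of_ge (y := OrderDual.toDual B) hBF hBP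
  have haB : a ∈ B.nonunits := hB2 ⟨⟨a, Polynomial.X, by simp⟩, ⟨1, by simp⟩, rfl⟩
  have ha1 : P.valuation a = 1 := by simpa using hv1 0
  have ha0 : a ≠ 0 := by rintro rfl; simp at ha1
  have : a⁻¹ ∈ P := by
    rw [← P.valuation_le_one_iff, map_inv₀, ha1, inv_one]
  rcases B.mem_nonunits_iff_or.1 haB with h | h
  · exact ha0 h
  · exact h (hPB this)

/-- elements of a subspace of valuation below a bound -/
def ltSub {F K Γ : Type*} [Field F] [Field K] [Algebra F K] [LinearOrderedCommGroupWithZero Γ]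
    (v : Valuation K Γ) (hF : ∀ c : F, v (algebraMap F K c) ≤ 1) (W : Submodule F K) (g : Γ)
    (hg : g ≠ 0) : Submodule F K where
  carrier := {w | w ∈ W ∧ v w < g}
  add_mem' := by
    rintro a b ⟨ha, ha'⟩ ⟨hb, hb'⟩
    exact ⟨add_mem ha hb, Valuation.map_add_lt _ ha' hb'⟩
  zero_mem' := ⟨zero_mem _, by simpa using zero_lt_iff.2 hg⟩
  smul_mem' := by
    rintro c x ⟨hx, hx'⟩
    refine ⟨W.smul_mem c hx, ?_⟩
    rw [Algebra.smul_def, map_mul]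
    exact lt_of_le_of_lt (mul_le_of_le_one_left' (hF c)) hx'

lemma exists_strictAnti_family {F K Γ : Type*} [Field F] [Field K] [Algebra F K]
    [LinearOrderedCommGroupWithZero Γ] (v : Valuation K Γ)
    (hF : ∀ c : F, v (algebraMap F K c) ≤ 1)
    (hres : ∀ x, v x ≤ 1 → ∃ c : F, v (x - algebraMap F K c) < 1) (k : ℕ) :
    ∀ W : Submodule F K, FiniteDimensional F W → k ≤ Module.finrank F W →
      ∃ f : Fin k → K, (∀ r, f r ∈ W) ∧ (∀ r, f r ≠ 0) ∧ LinearIndependent F f ∧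
        ∀ r s, r < s → v (f s) < v (f r) := by
  induction k with
  | zero =>
    intro W _ _
    exact ⟨fun r => r.elim0, fun r => r.elim0, fun r => r.elim0, linearIndependent_empty_type,
      fun r => r.elim0⟩
  | succ k ih =>
    intro W hfd hW
    have hbound : ∃ f0 ∈ W, f0 ≠ 0 ∧ ∀ w ∈ W, v w ≤ v f0 := by
      let b := Module.finBasis F W
      have : Nonempty (Fin (Module.finrank F W)) := ⟨⟨0, by omega⟩⟩
      obtain ⟨i, -, hi⟩ := Finset.exists_max_image Finset.univ (fun i => v (b i : K))
        Finset.univ_nonempty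
      refine ⟨b i, (b i).2, by simpa using b.ne_zero i, ?_⟩
      intro w hw
      have h := congrArg (Subtype.val) (b.sum_repr ⟨w, hw⟩)
      change v ((⟨w, hw⟩ : W) : K) ≤ _
      rw [← h, AddSubmonoidClass.coe_finset_sum]
      refine Valuation.map_sum_le _ fun j _ => ?_
      rw [SetLike.val_smul, Algebra.smul_def, map_mul]
      exact le_trans (mul_le_of_le_one_left' (hF _)) (hi j (Finset.mem_univ _))
    obtain ⟨f0, hf0W, hf0, hmax⟩ := hbound
    have hg : v f0 ≠ 0 := (Valuation.ne_zero_iff _).2 hf0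
    set W' := ltSub v hF W (v f0) hg with hW'
    have hle : W' ≤ W := fun w hw => hw.1
    have : FiniteDimensional F W' := Submodule.finiteDimensional_of_le hle
    have hsup : W ≤ W' ⊔ Submodule.span F {f0} := by
      intro w hw
      have h1 : v (w / f0) ≤ 1 := by
        rw [map_div₀]; exact div_le_one_of_le₀ (hmax w hw) zero_le
      obtain ⟨c, hc⟩ := hres _ h1
      have h2 : w - c • f0 ∈ W' := by
        refine ⟨sub_mem hw (W.smul_mem _ hf0W), ?_⟩
        have : w - c • f0 = (w / f0 - algebraMap F K c) * f0 := by
          rw [Algebra.smul_def]; field_simp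
        rw [this, map_mul]
        calc _ < 1 * v f0 := (mul_lt_mul_iff_left₀ (zero_lt_iff.2 hg)).2 hc
          _ = _ := one_mul _
      have : w = (w - c • f0) + c • f0 := by ring
      rw [this]
      exact add_mem (Submodule.mem_sup_left h2)
        (Submodule.mem_sup_right (Submodule.smul_mem _ _ (Submodule.mem_span_singleton_self _)))
    have hfr : k ≤ Module.finrank F W' := by
      have h1 := Submodule.finrank_mono hsup
      have h2 := Submodule.finrank_add_le_finrank_add_finrank W' (Submodule.span F {f0})
      have h3 : Module.finrank F (Submodule.span F {f0}) ≤ 1 := by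
        simpa using finrank_span_le_card (R := F) ({f0} : Set K)
      omega
    obtain ⟨f, hf1, hf2, hf3, hf4⟩ := ih W' inferInstance hfr
    refine ⟨Fin.cons f0 f, ?_, ?_, ?_, ?_⟩
    · intro r
      refine Fin.cases ?_ (fun r => ?_) r
      · exact hf0W
      · exact hle (hf1 r)
    · intro r
      refine Fin.cases ?_ (fun r => ?_) r
      · exact hf0
      · exact hf2 r
    · rw [linearIndependent_finCons]
      refine ⟨hf3, fun h => ?_⟩
      have : f0 ∈ W' := (Submodule.span_le.2 (by rintro _ ⟨r, rfl⟩; exact hf1 r)) h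
      exact lt_irrefl _ this.2
    · intro r s
      refine Fin.cases ?_ (fun r => ?_) r
      · refine Fin.cases ?_ (fun s => ?_) s
        · intro h; exact absurd h (lt_irrefl _)
        · intro _; exact (hf1 s).2
      · refine Fin.cases ?_ (fun s => ?_) s
        · intro h; exact absurd h (by simp)
        · intro h; exact hf4 r s (by simpa using h)

lemma exists_adapted_matrix {F K Γ : Type*} [Field F] [Field K] [Algebra F K]
    [LinearOrderedCommGroupWithZero Γ] (v : Valuation K Γ)
    (hF : ∀ c : F, v (algebraMap F K c) ≤ 1)
    (hres : ∀ x, v x ≤ 1 → ∃ c : F, v (x - algebraMap F K c) < 1) (k : ℕ)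
    (x : Fin k → K) (hx : LinearIndependent F x) :
    ∃ M : Matrix (Fin k) (Fin k) F, IsUnit M ∧
      (∀ r, (∑ t, algebraMap F K (M r t) * x t) ≠ 0) ∧
      ∀ r s, r < s → v (∑ t, algebraMap F K (M s t) * x t) <
        v (∑ t, algebraMap F K (M r t) * x t) := by
  obtain ⟨f, hf1, hf2, hf3, hf4⟩ := exists_strictAnti_family v hF hres k
    (Submodule.span F (Set.range x))
    (FiniteDimensional.span_of_finite F (Set.finite_range x)) (by rw [finrank_span_eq_card hx]; simp)
  have h : ∀ r, ∃ c : Fin k → F, ∑ t, c t • x t = f r := fun r =>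
    (Submodule.mem_span_range_iff_exists_fun F).1 (hf1 r)
  choose M hM using h
  have hM' : ∀ r, (∑ t, algebraMap F K (Matrix.of M r t) * x t) = f r := by
    intro r; rw [← hM r]; simp [Algebra.smul_def]
  refine ⟨Matrix.of M, ?_, ?_, ?_⟩
  · rw [← Matrix.linearIndependent_rows_iff_isUnit, Fintype.linearIndependent_iff]
    intro g hg
    rw [Fintype.linearIndependent_iff] at hf3
    apply hf3 g
    simp_rw [← hM, Finset.smul_sum, smul_smul]
    rw [Finset.sum_comm]
    refine Finset.sum_eq_zero fun t _ => ?_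
    rw [← Finset.sum_smul]
    have := congrFun hg t
    simp only [Finset.sum_apply, Pi.smul_apply, Matrix.row, Matrix.of_apply, smul_eq_mul,
      Pi.zero_apply] at this
    rw [this, zero_smul]
  · intro r; rw [hM']; exact hf2 r
  · intro r s h; rw [hM', hM']; exact hf4 r s h

lemma exists_minor_s19 {L ρ κ : Type*} [Field L] [Fintype ρ] [Fintype κ] [DecidableEq κ]
    (M : Matrix ρ κ L) (h : ∀ w : κ → L, M *ᵥ w = 0 → w = 0) :
    ∃ s : κ → ρ, (M.submatrix s id).det ≠ 0 := by
  have hspan : Submodule.span L (Set.range M.row) = ⊤ := by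
    have hinj : Function.Injective M.mulVecLin := by
      rw [← LinearMap.ker_eq_bot, LinearMap.ker_eq_bot']
      exact h
    have hr : M.rank = Fintype.card κ := by
      rw [Matrix.rank, LinearMap.finrank_range_of_inj hinj, Module.finrank_fintype_fun_eq_card]
    rw [Matrix.rank_eq_finrank_span_row] at hr
    apply Submodule.eq_top_of_finrank_eq
    rw [hr, Module.finrank_fintype_fun_eq_card]
  obtain ⟨κ', a, ha, hs, hli⟩ := exists_linearIndependent' L M.row
  rw [hspan] at hs
  have hb : Module.Basis κ' L (κ → L) := Module.Basis.mk hli hs.ge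
  have : Finite κ' := Module.Finite.finite_basis hb
  have : Fintype κ' := Fintype.ofFinite κ'
  have hc : Fintype.card κ = Fintype.card κ' := by
    rw [← Module.finrank_eq_card_basis hb, Module.finrank_fintype_fun_eq_card]
  let e : κ ≃ κ' := Fintype.equivOfCardEq hc
  refine ⟨a ∘ e, ?_⟩
  have h2 : LinearIndependent L (M.submatrix (a ∘ e) id).row := hli.comp e e.injective
  rw [Matrix.linearIndependent_rows_iff_isUnit, Matrix.isUnit_iff_isUnit_det] at h2
  exact h2.ne_zero

/-- `u` solves the incidence system of the hypergraph `S` (restricted to `U`) with flag `σ`. -/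
def Sol {ι L : Type*} [CommRing L] {n k : ℕ} (U : Finset ι) (S : Fin n → Finset ι) (σ : ι → ℕ)
    (v : Fin n → Fin k → L) (u : ι → Fin k → L) : Prop :=
  (∀ j, ∀ i ∈ U, ∀ i' ∈ U, i ∈ S j → i' ∈ S j →
    ∑ t, v j t * u i t = ∑ t, v j t * u i' t) ∧
  (∀ r : Fin k, ∀ i ∈ U, ∀ i' ∈ U, (r : ℕ) < σ i → (r : ℕ) < σ i' → u i r = u i' r)

/-- All solutions are constant on `U`. -/
def Good {ι L : Type*} [CommRing L] {n k : ℕ} (U : Finset ι) (S : Fin n → Finset ι) (σ : ι → ℕ)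
    (v : Fin n → Fin k → L) : Prop :=
  ∀ u : ι → Fin k → L, Sol U S σ v u → ∀ i ∈ U, ∀ i' ∈ U, u i = u i'

/-- The matrix of the system, normalised at `root`. -/
def sysMat {ι A : Type*} [DecidableEq ι] [CommRing A] {n k : ℕ} (U : Finset ι)
    (S : Fin n → Finset ι) (σ : ι → ℕ) (root : ι) (v : Fin n → Fin k → A) :
    Matrix ((Fin n × ι × ι) ⊕ (Fin k × ι × ι) ⊕ (ι × Fin k)) (ι × Fin k) A :=
  fun e x => match e with
  | Sum.inl (j, i, i') => if i ∈ U ∧ i' ∈ U ∧ i ∈ S j ∧ i' ∈ S j then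
      ((if x.1 = i then 1 else 0) - (if x.1 = i' then 1 else 0)) * v j x.2 else 0
  | Sum.inr (Sum.inl (r, i, i')) => if i ∈ U ∧ i' ∈ U ∧ (r : ℕ) < σ i ∧ (r : ℕ) < σ i' then
      ((if x.1 = i then 1 else 0) - (if x.1 = i' then 1 else 0)) * (if x.2 = r then 1 else 0)
      else 0
  | Sum.inr (Sum.inr (y, s)) => if y ∉ U ∨ y = root then
      (if x.1 = y then 1 else 0) * (if x.2 = s then 1 else 0) else 0

lemma sysMat_map {ι A B : Type*} [DecidableEq ι] [CommRing A] [CommRing B] (φ : A →+* B)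
    {n k : ℕ} (U : Finset ι)
    (S : Fin n → Finset ι) (σ : ι → ℕ) (root : ι) (v : Fin n → Fin k → A) :
    (sysMat U S σ root v).map φ = sysMat U S σ root (fun j t => φ (v j t)) := by
  ext e x
  rcases e with ⟨j, i, i'⟩ | ⟨r, i, i'⟩ | ⟨y, s⟩ <;>
    simp only [sysMat, Matrix.map_apply] <;> split_ifs <;> simp

lemma sysMat_ker {ι L : Type*} [Fintype ι] [DecidableEq ι] [CommRing L] {n k : ℕ}
    (U : Finset ι) (S : Fin n → Finset ι) (σ : ι → ℕ) (root : ι)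
    (v : Fin n → Fin k → L) (w : ι × Fin k → L) :
    sysMat U S σ root v *ᵥ w = 0 ↔ Sol U S σ v (fun i t => w (i, t)) ∧
      ∀ y, (y ∉ U ∨ y = root) → ∀ s, w (y, s) = 0 := by
  have h1 : ∀ j i i', (sysMat U S σ root v *ᵥ w) (Sum.inl (j, i, i')) =
      if i ∈ U ∧ i' ∈ U ∧ i ∈ S j ∧ i' ∈ S j then
      (∑ t, v j t * w (i, t)) - ∑ t, v j t * w (i', t) else 0 := by
    intro j i i'
    simp only [Matrix.mulVec, dotProduct, sysMat]
    split_ifs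
    · simp [Fintype.sum_prod_type, sub_mul, Finset.sum_sub_distrib, ite_mul]
    · simp
  have h2 : ∀ r i i', (sysMat U S σ root v *ᵥ w) (Sum.inr (Sum.inl (r, i, i'))) =
      if i ∈ U ∧ i' ∈ U ∧ (r : ℕ) < σ i ∧ (r : ℕ) < σ i' then
      w (i, r) - w (i', r) else 0 := by
    intro j i i'
    simp only [Matrix.mulVec, dotProduct, sysMat]
    split_ifs
    · simp [Fintype.sum_prod_type, sub_mul, Finset.sum_sub_distrib, ite_mul]
    · simp
  have h3 : ∀ y s, (sysMat U S σ root v *ᵥ w) (Sum.inr (Sum.inr (y, s))) =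
      if y ∉ U ∨ y = root then w (y, s) else 0 := by
    intro y s
    simp only [Matrix.mulVec, dotProduct, sysMat]
    split_ifs
    · simp [Fintype.sum_prod_type, ite_mul]
    · simp
  constructor
  · intro h
    refine ⟨⟨?_, ?_⟩, ?_⟩
    · intro j i hi i' hi' hj hj'
      have := congrFun h (Sum.inl (j, i, i'))
      rw [h1, if_pos ⟨hi, hi', hj, hj'⟩] at this
      exact sub_eq_zero.1 this
    · intro j i hi i' hi' hj hj'
      have := congrFun h (Sum.inr (Sum.inl (j, i, i')))
      rw [h2, if_pos ⟨hi, hi', hj, hj'⟩] at this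
      exact sub_eq_zero.1 this
    · intro y hy s
      have := congrFun h (Sum.inr (Sum.inr (y, s)))
      rw [h3, if_pos hy] at this
      exact this
  · rintro ⟨⟨ha, hb⟩, hc⟩
    ext e
    rcases e with ⟨j, i, i'⟩ | ⟨r, i, i'⟩ | ⟨y, s⟩
    · rw [h1]
      split_ifs with h
      · exact sub_eq_zero.2 (ha j i h.1 i' h.2.1 h.2.2.1 h.2.2.2)
      · rfl
    · rw [h2]
      split_ifs with h
      · exact sub_eq_zero.2 (hb r i h.1 i' h.2.1 h.2.2.1 h.2.2.2)
      · rfl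
    · rw [h3]
      split_ifs with h
      · exact hc y h s
      · rfl

lemma good_iff {ι L : Type*} [Fintype ι] [DecidableEq ι] [CommRing L] {n k : ℕ}
    (U : Finset ι) (S : Fin n → Finset ι) (σ : ι → ℕ) (root : ι) (hroot : root ∈ U)
    (v : Fin n → Fin k → L) :
    Good U S σ v ↔ ∀ w, sysMat U S σ root v *ᵥ w = 0 → w = 0 := by
  constructor
  · intro h w hw
    rw [sysMat_ker] at hw
    ext ⟨y, s⟩
    by_cases hy : y ∈ U
    · have := congrFun (h _ hw.1 y hy root hroot) s
      exact this.trans (hw.2 _ (Or.inr rfl) s)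
    · exact hw.2 _ (Or.inl hy) s
  · intro h u hu
    have := h (fun x => if x.1 ∈ U then u x.1 x.2 - u root x.2 else 0) (by
      rw [sysMat_ker]
      refine ⟨⟨?_, ?_⟩, ?_⟩
      · intro j i hi i' hi' hj hj'
        simp only [hi, hi', if_true, mul_sub, Finset.sum_sub_distrib]
        rw [hu.1 j i hi i' hi' hj hj']
      · intro r i hi i' hi' hj hj'
        simp only [hi, hi', if_true]
        rw [hu.2 r i hi i' hi' hj hj']
      · rintro y (hy | rfl) s
        · simp [hy]
        · simp)
    have h2 : ∀ i ∈ U, u i = u root := by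
      intro i hi
      ext s
      have := congrFun this (i, s)
      simp only [hi, if_true, Pi.zero_apply] at this
      exact sub_eq_zero.1 this
    intro i hi i' hi'
    rw [h2 i hi, h2 i' hi']

lemma sysMat_det_map {ι F B : Type*} [Fintype ι] [DecidableEq ι] [Field F] [CommRing B]
    {n k : ℕ} (U : Finset ι) (S : Fin n → Finset ι) (σ : ι → ℕ) (root : ι)
    (s : ι × Fin k → (Fin n × ι × ι) ⊕ (Fin k × ι × ι) ⊕ (ι × Fin k))
    (φ : MvPolynomial (Fin n × Fin k) F →+* B) :
    φ ((sysMat U S σ root (fun j t => (MvPolynomial.X (j, t) :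
        MvPolynomial (Fin n × Fin k) F))).submatrix s id).det =
      ((sysMat U S σ root (fun j t => φ (MvPolynomial.X (j, t)))).submatrix s id).det := by
  rw [← sysMat_map φ U S σ root (fun j t => MvPolynomial.X (j, t)), RingHom.map_det]
  rfl

/-- Goodness is an open condition, defined over `F`. -/
lemma good_open {ι F L : Type*} [Fintype ι] [DecidableEq ι] [Field F] [Field L] [Algebra F L]
    {n k : ℕ} (U : Finset ι) (S : Fin n → Finset ι) (σ : ι → ℕ) (hU : U.Nonempty)
    (v : Fin n → Fin k → L) (h : Good U S σ v) :
    ∃ D : MvPolynomial (Fin n × Fin k) F, MvPolynomial.aeval (fun x => v x.1 x.2) D ≠ 0 ∧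
      ∀ v' : Fin n → Fin k → F, MvPolynomial.eval (fun x => v' x.1 x.2) D ≠ 0 →
        Good U S σ v' := by
  obtain ⟨root, hroot⟩ := hU
  rw [good_iff U S σ root hroot] at h
  obtain ⟨s, hs⟩ := exists_minor_s19 _ h
  let M : Matrix _ _ (MvPolynomial (Fin n × Fin k) F) :=
    sysMat U S σ root (fun j t => MvPolynomial.X (j, t))
  refine ⟨(M.submatrix s id).det, ?_, ?_⟩
  · have := sysMat_det_map U S σ root s (MvPolynomial.aeval (R := F) (fun x : Fin n × Fin k => v x.1 x.2)).toRingHom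
    simp only [AlgHom.toRingHom_eq_coe, RingHom.coe_coe, MvPolynomial.aeval_X] at this
    rw [this]
    exact hs
  · intro v' hv'
    rw [sysMat_det_map U S σ root s (MvPolynomial.eval (fun x : Fin n × Fin k => v' x.1 x.2))] at hv'
    simp only [MvPolynomial.eval_X] at hv'
    rw [good_iff U S σ root hroot]
    intro w hw
    refine Matrix.eq_zero_of_mulVec_eq_zero hv' ?_
    ext x
    exact congrFun hw (s x)

/-- Sparsity defect of the vertex set `p`. -/
def hh {ι : Type*} [DecidableEq ι] {n : ℕ} (k : ℕ) (S : Fin n → Finset ι) (σ : ι → ℕ)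
    (p : Finset ι) : ℤ :=
  (k : ℤ) * ((p.card : ℤ) - 1) - ∑ j, (((S j ∩ p).card - 1 : ℕ) : ℤ) - ∑ i ∈ p, (σ i : ℤ)
    + ((p.sup σ : ℕ) : ℤ)

/-- Contraction of `p` to the vertex `x0`. -/
def contr {ι : Type*} [DecidableEq ι] {n : ℕ} (S : Fin n → Finset ι) (p : Finset ι) (x0 : ι) :
    Fin n → Finset ι :=
  fun j => if (S j ∩ p).Nonempty then insert x0 (S j \ p) else S j

lemma hh_contr_of_disjoint {ι : Type*} [DecidableEq ι] {n : ℕ} (k : ℕ) (S : Fin n → Finset ι)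
    (σ : ι → ℕ) (p q : Finset ι) (x0 : ι) (hx0 : x0 ∈ p) (hq : Disjoint q p) :
    hh k (contr S p x0) σ q = hh k S σ q := by
  have h : ∀ j, contr S p x0 j ∩ q = S j ∩ q := by
    intro j
    ext i
    have h1 : i ∈ q → i ∉ p := fun h => Finset.disjoint_left.1 hq h
    have h2 : i ∈ q → i ≠ x0 := fun h e => h1 h (e ▸ hx0)
    simp only [contr]
    split_ifs <;> simp <;> tauto
  simp only [hh, h]

lemma hh_contr {ι : Type*} [DecidableEq ι] {n : ℕ} (k : ℕ) (S : Fin n → Finset ι)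
    (σ : ι → ℕ) (p q0 : Finset ι) (x0 : ι) (hx0 : x0 ∈ p) (hq : Disjoint q0 p)
    (hσ : σ x0 = p.sup σ) :
    hh k (contr S p x0) σ (insert x0 q0) = hh k S σ (q0 ∪ p) - hh k S σ p := by
  have hx : x0 ∉ q0 := fun h => Finset.disjoint_left.1 hq h hx0
  have hdis : ∀ j, Disjoint (S j ∩ q0) (S j ∩ p) := fun j =>
    hq.mono Finset.inter_subset_right Finset.inter_subset_right
  have hj : ∀ j, (((contr S p x0 j ∩ insert x0 q0).card - 1 : ℕ) : ℤ) =
      (((S j ∩ (q0 ∪ p)).card - 1 : ℕ) : ℤ) - (((S j ∩ p).card - 1 : ℕ) : ℤ) := by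
    intro j
    have e1 : (S j ∩ (q0 ∪ p)).card = (S j ∩ q0).card + (S j ∩ p).card := by
      rw [Finset.inter_union_distrib_left, Finset.card_union_of_disjoint (hdis j)]
    by_cases hne : (S j ∩ p).Nonempty
    · have e2 : contr S p x0 j ∩ insert x0 q0 = insert x0 (S j ∩ q0) := by
        ext i
        have h1 : i ∈ q0 → i ∉ p := fun h => Finset.disjoint_left.1 hq h
        simp only [contr, if_pos hne]
        simp
        tauto
      have e3 : x0 ∉ S j ∩ q0 := fun h => hx (Finset.mem_inter.1 h).2
      rw [e2, Finset.card_insert_of_notMem e3, e1]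
      have := hne.card_pos
      omega
    · have e2 : contr S p x0 j ∩ insert x0 q0 = S j ∩ q0 := by
        ext i
        have h1 : x0 ∉ S j := fun h => hne ⟨x0, Finset.mem_inter.2 ⟨h, hx0⟩⟩
        simp only [contr, if_neg hne]
        simp
        rintro h rfl
        exact absurd h h1
      rw [Finset.not_nonempty_iff_eq_empty] at hne
      rw [e2, e1, hne]
      simp
  have hsup : (insert x0 q0).sup σ = (q0 ∪ p).sup σ := by
    rw [Finset.sup_insert, Finset.sup_union, hσ, sup_comm]
  simp only [hh, hj, hsup, Finset.sum_sub_distrib, Finset.card_insert_of_notMem hx,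
    Finset.card_union_of_disjoint hq, Finset.sum_insert hx, Finset.sum_union hq, hσ]
  push_cast
  ring

/-- raised flag -/
def raise {ι : Type*} [DecidableEq ι] (σ : ι → ℕ) (T : Finset ι) : ι → ℕ :=
  fun i => if i ∈ T then σ i + 1 else σ i

lemma hh_raise_aux {ι : Type*} [DecidableEq ι] {n : ℕ} (k : ℕ) (S : Fin n → Finset ι)
    (σ : ι → ℕ) (j0 : Fin n) (p : Finset ι) :
    hh k (Function.update S j0 ∅) (raise σ (S j0)) p = hh k S σ p
      + (((S j0 ∩ p).card - 1 : ℕ) : ℤ) - ((S j0 ∩ p).card : ℤ)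
      + ((p.sup (raise σ (S j0)) : ℕ) : ℤ) - ((p.sup σ : ℕ) : ℤ) := by
  have h1 : ∑ j, (((S j ∩ p).card - 1 : ℕ) : ℤ) = (((S j0 ∩ p).card - 1 : ℕ) : ℤ)
      + ∑ j, (((Function.update S j0 ∅ j ∩ p).card - 1 : ℕ) : ℤ) := by
    rw [← Finset.add_sum_erase _ _ (Finset.mem_univ j0),
      ← Finset.add_sum_erase (Finset.univ) (fun j =>
        (((Function.update S j0 ∅ j ∩ p).card - 1 : ℕ) : ℤ)) (Finset.mem_univ j0)]
    simp only [Function.update_self, Finset.empty_inter, Finset.card_empty]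
    simp only [Nat.zero_sub, Nat.cast_zero, zero_add, add_right_inj]
    refine Finset.sum_congr rfl fun j hj => ?_
    rw [Function.update_of_ne (Finset.ne_of_mem_erase hj)]
  have h2 : ∑ i ∈ p, ((raise σ (S j0) i : ℕ) : ℤ) = ∑ i ∈ p, (σ i : ℤ)
      + ((S j0 ∩ p).card : ℤ) := by
    have : ∀ i, ((raise σ (S j0) i : ℕ) : ℤ) = (σ i : ℤ) + if i ∈ S j0 then 1 else 0 := by
      intro i; simp only [raise]; split_ifs <;> simp
    simp only [this, Finset.sum_add_distrib]
    rw [Finset.sum_boole, Finset.filter_mem_eq_inter, Finset.inter_comm]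
  simp only [hh, h1, h2]
  ring

lemma hh_raise_ge {ι : Type*} [DecidableEq ι] {n : ℕ} (k : ℕ) (S : Fin n → Finset ι)
    (σ : ι → ℕ) (j0 : Fin n) (p : Finset ι) :
    hh k S σ p - 1 ≤ hh k (Function.update S j0 ∅) (raise σ (S j0)) p := by
  rw [hh_raise_aux]
  have : p.sup σ ≤ p.sup (raise σ (S j0)) := by
    apply Finset.sup_mono_fun
    intro i _
    simp only [raise]; split_ifs <;> omega
  omega

lemma hh_raise_eq {ι : Type*} [DecidableEq ι] {n : ℕ} (k : ℕ) (S : Fin n → Finset ι)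
    (σ : ι → ℕ) (j0 : Fin n) (p : Finset ι)
    (h : ∃ x ∈ p, x ∈ S j0 ∧ σ x = p.sup σ) :
    hh k (Function.update S j0 ∅) (raise σ (S j0)) p = hh k S σ p := by
  obtain ⟨x, hxp, hxS, hx⟩ := h
  rw [hh_raise_aux]
  have h1 : p.sup (raise σ (S j0)) = p.sup σ + 1 := by
    apply le_antisymm
    · apply Finset.sup_le
      intro i hi
      have := Finset.le_sup (f := σ) hi
      simp only [raise]; split_ifs <;> omega
    · rw [← hx]
      refine le_trans ?_ (Finset.le_sup (f := raise σ (S j0)) hxp)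
      simp [raise, hxS]
  have h2 : 0 < (S j0 ∩ p).card := Finset.card_pos.2 ⟨x, Finset.mem_inter.2 ⟨hxS, hxp⟩⟩
  rw [h1]
  push_cast
  omega

lemma hh_raise_eq' {ι : Type*} [DecidableEq ι] {n : ℕ} (k : ℕ) (S : Fin n → Finset ι)
    (σ : ι → ℕ) (j0 : Fin n) (p : Finset ι) (h : S j0 ∩ p = ∅) :
    hh k (Function.update S j0 ∅) (raise σ (S j0)) p = hh k S σ p := by
  rw [hh_raise_aux, h]
  have h1 : p.sup (raise σ (S j0)) = p.sup σ := by
    apply Finset.sup_congr rfl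
    intro i hi
    have : i ∉ S j0 := fun h' => by
      have := Finset.mem_inter.2 ⟨h', hi⟩
      rw [h] at this; simp at this
    simp [raise, this]
  rw [h1]; simp

/-- Existence of a hyperedge meeting the top of the flag. -/
lemma exists_edge {ι : Type*} [DecidableEq ι] {n : ℕ} (k : ℕ) (S : Fin n → Finset ι)
    (σ : ι → ℕ) (U : Finset ι) (hcard : 2 ≤ U.card)
    (hpos : ∀ p ⊆ U, p.Nonempty → 0 ≤ hh k S σ p) (hU : hh k S σ U = 0)
    (x0 : ι) (hx0 : x0 ∈ U) (hx : σ x0 = U.sup σ) (hlt : ∀ x ∈ U, x ≠ x0 → σ x < k) :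
    ∃ j, 2 ≤ (S j ∩ U).card ∧ ∃ x ∈ U, x ∈ S j ∧ σ x = U.sup σ := by
  by_contra! hcon
  set D := U.filter (fun x => σ x = U.sup σ) with hD
  set p := U.filter (fun x => ¬ σ x = U.sup σ) with hp
  have hx0D : x0 ∈ D := by simp [hD, hx0, hx]
  have hcardU : D.card + p.card = U.card := Finset.card_filter_add_card_filter_not _
  have hDpos : 0 < D.card := Finset.card_pos.2 ⟨x0, hx0D⟩
  have hS : ∀ j, ((S j ∩ p).card - 1 : ℕ) = ((S j ∩ U).card - 1 : ℕ) := by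
    intro j
    by_cases h2 : 2 ≤ (S j ∩ U).card
    · have : S j ∩ p = S j ∩ U := by
        ext i
        have := hcon j h2 i
        simp only [hp, Finset.mem_inter, Finset.mem_filter]
        tauto
      rw [this]
    · have : (S j ∩ p).card ≤ (S j ∩ U).card :=
        Finset.card_le_card (Finset.inter_subset_inter_left (Finset.filter_subset _ _))
      omega
  have hsum : ∑ i ∈ U, (σ i : ℤ) = (D.card : ℤ) * (U.sup σ : ℕ) + ∑ i ∈ p, (σ i : ℤ) := by
    rw [← Finset.sum_filter_add_sum_filter_not U (fun x => σ x = U.sup σ)]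
    congr 1
    rw [Finset.sum_congr rfl (g := fun _ => ((U.sup σ : ℕ) : ℤ))]
    · simp [hD]
    · intro i hi
      rw [(Finset.mem_filter.1 hi).2]
  set R := U.sup σ with hR
  have hRlt : R < k ∨ D.card = 1 := by
    by_contra! h
    have h2 : 1 < D.card := by omega
    obtain ⟨y, hy, hyx⟩ := Finset.exists_mem_ne h2 x0
    have := hlt y (Finset.mem_filter.1 hy).1 hyx
    have h3 := (Finset.mem_filter.1 hy).2
    omega
  rcases p.eq_empty_or_nonempty with hpe | hpne
  · have h0 : ∑ j, (((S j ∩ U).card - 1 : ℕ) : ℤ) = 0 := by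
      refine Finset.sum_eq_zero fun j _ => ?_
      rw [← hS j, hpe]; simp
    rw [hpe] at hcardU hsum
    simp only [Finset.card_empty, Finset.sum_empty] at hcardU hsum
    rcases hRlt with h | h
    · simp only [hh, h0, hsum] at hU
      have e : (U.card : ℤ) = D.card := by omega
      rw [e] at hU
      have h3 : ((k : ℤ) - R) * ((D.card : ℤ) - 1) = 0 := by linarith
      have h4 : (0 : ℤ) < ((k : ℤ) - R) * ((D.card : ℤ) - 1) := by
        apply mul_pos <;> omega
      omega
    · omega
  · have h1 := hpos p (Finset.filter_subset _ _) hpne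
    simp only [hh, hS] at h1
    simp only [hh, hsum] at hU
    have e : (U.card : ℤ) = D.card + p.card := by omega
    rw [e] at hU
    obtain ⟨y, hy, hy'⟩ := Finset.exists_mem_eq_sup p hpne σ
    have hyU := (Finset.mem_filter.1 hy).1
    have hyne := (Finset.mem_filter.1 hy).2
    have hyR : σ y < R := lt_of_le_of_ne (Finset.le_sup (f := σ) hyU) hyne
    have hyk : σ y < k := hlt y hyU (by rintro rfl; exact hyne hx)
    rw [hy'] at h1
    have h3 : (k : ℤ) * D.card ≤ D.card * R - R + σ y := by linarith
    rcases hRlt with h | h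
    · have : (D.card : ℤ) * R ≤ D.card * k := by
        apply mul_le_mul_of_nonneg_left <;> omega
      have e2 : (k : ℤ) * D.card = D.card * k := mul_comm _ _
      omega
    · rw [h] at h3
      push_cast at h3
      omega

/-- Substitute the coordinates of `v` in all blocks but the `m`-th one. -/
def substAt {F : Type*} [Field F] {n k : ℕ} (D : MvPolynomial (Fin n × Fin k) F)
    (v : Fin n → Fin k → F) (m : Fin n) : MvPolynomial (Fin k) F :=
  MvPolynomial.aeval (fun x => if x.1 = m then MvPolynomial.X x.2
    else MvPolynomial.C (v x.1 x.2)) D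

lemma aeval_substAt {F K : Type*} [Field F] [Field K] [Algebra F K] {n k : ℕ}
    (D : MvPolynomial (Fin n × Fin k) F)
    (v : Fin n → Fin k → F) (m : Fin n) (f : Fin k → K) :
    MvPolynomial.aeval f (substAt D v m) = MvPolynomial.aeval
      (fun x => Function.update (fun j t => algebraMap F K (v j t)) m f x.1 x.2) D := by
  rw [substAt, ← AlgHom.comp_apply, MvPolynomial.comp_aeval]
  congr 2
  ext x
  by_cases h : x.1 = m
  · rw [if_pos h, h]; simp
  · rw [if_neg h]; simp [Function.update_of_ne h, MvPolynomial.aeval_C]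

lemma eval_substAt {F : Type*} [Field F] {n k : ℕ}
    (D : MvPolynomial (Fin n × Fin k) F)
    (v : Fin n → Fin k → F) (m : Fin n) (f : Fin k → F) :
    MvPolynomial.eval f (substAt D v m) = MvPolynomial.eval
      (fun x => Function.update v m f x.1 x.2) D := by
  have := aeval_substAt D v m f
  simpa [MvPolynomial.aeval_eq_eval] using this

/-- Irreducibility, phrased by polynomials. -/
def Irr {F : Type*} [Field F] {k : ℕ} (Y : Set (Fin k → F)) : Prop :=
  ∀ D1 D2 : MvPolynomial (Fin k) F, (∃ y ∈ Y, MvPolynomial.eval y D1 ≠ 0) →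
    (∃ y ∈ Y, MvPolynomial.eval y D2 ≠ 0) →
    ∃ y ∈ Y, MvPolynomial.eval y D1 ≠ 0 ∧ MvPolynomial.eval y D2 ≠ 0

lemma irr_prod {F : Type*} [Field F] {n k : ℕ} (Y : Set (Fin k → F)) (hY : Irr Y)
    (D1 D2 : MvPolynomial (Fin n × Fin k) F)
    (h1 : ∃ v : Fin n → Fin k → F, (∀ j, v j ∈ Y) ∧
      MvPolynomial.eval (fun x => v x.1 x.2) D1 ≠ 0)
    (h2 : ∃ v : Fin n → Fin k → F, (∀ j, v j ∈ Y) ∧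
      MvPolynomial.eval (fun x => v x.1 x.2) D2 ≠ 0) :
    ∃ v : Fin n → Fin k → F, (∀ j, v j ∈ Y) ∧
      MvPolynomial.eval (fun x => v x.1 x.2) D1 ≠ 0 ∧
      MvPolynomial.eval (fun x => v x.1 x.2) D2 ≠ 0 := by
  have key : ∀ m : ℕ, m ≤ n → ∃ v w : Fin n → Fin k → F, (∀ j, v j ∈ Y) ∧ (∀ j, w j ∈ Y) ∧
      MvPolynomial.eval (fun x => v x.1 x.2) D1 ≠ 0 ∧
      MvPolynomial.eval (fun x => w x.1 x.2) D2 ≠ 0 ∧ ∀ j : Fin n, (j : ℕ) < m → v j = w j := by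
    intro m
    induction m with
    | zero =>
      intro _
      obtain ⟨v, hv, hv'⟩ := h1
      obtain ⟨w, hw, hw'⟩ := h2
      exact ⟨v, w, hv, hw, hv', hw', fun j hj => absurd hj (by omega)⟩
    | succ m ih =>
      intro hm
      obtain ⟨v, w, hv, hw, hv', hw', h⟩ := ih (by omega)
      let m' : Fin n := ⟨m, by omega⟩
      obtain ⟨y, hy, hy1, hy2⟩ := hY (substAt D1 v m') (substAt D2 w m')
        ⟨v m', hv m', by rw [eval_substAt, Function.update_eq_self]; exact hv'⟩
        ⟨w m', hw m', by rw [eval_substAt, Function.update_eq_self]; exact hw'⟩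
      rw [eval_substAt] at hy1 hy2
      refine ⟨Function.update v m' y, Function.update w m' y, ?_, ?_, hy1, hy2, ?_⟩
      · intro j
        by_cases hj : j = m'
        · subst hj; simpa using hy
        · rw [Function.update_of_ne hj]; exact hv j
      · intro j
        by_cases hj : j = m'
        · subst hj; simpa using hy
        · rw [Function.update_of_ne hj]; exact hw j
      · intro j hjm
        by_cases hj : j = m'
        · subst hj; simp
        · rw [Function.update_of_ne hj, Function.update_of_ne hj]
          apply h
          have : (j : ℕ) ≠ m := fun h => hj (Fin.ext h)
          omega
  obtain ⟨v, w, hv, hw, hv', hw', h⟩ := key n le_rfl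
  have : v = w := funext fun j => h j j.2
  subst this
  exact ⟨v, hv, hv', hw'⟩

/-- Nonempty open conditions on `Y ^ n`. -/
def Gen {F : Type*} [Field F] {n k : ℕ} (Y : Set (Fin k → F))
    (P : (Fin n → Fin k → F) → Prop) : Prop :=
  ∃ D : MvPolynomial (Fin n × Fin k) F,
    (∃ v : Fin n → Fin k → F, (∀ j, v j ∈ Y) ∧
      MvPolynomial.eval (fun x => v x.1 x.2) D ≠ 0) ∧
    ∀ v : Fin n → Fin k → F, MvPolynomial.eval (fun x => v x.1 x.2) D ≠ 0 → P v

lemma Gen.and {F : Type*} [Field F] {n k : ℕ} {Y : Set (Fin k → F)} (hY : Irr Y)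
    {P Q : (Fin n → Fin k → F) → Prop} (hP : Gen Y P) (hQ : Gen Y Q) :
    Gen Y (fun v => P v ∧ Q v) := by
  obtain ⟨D1, h1, h1'⟩ := hP
  obtain ⟨D2, h2, h2'⟩ := hQ
  obtain ⟨v, hv, ha, hb⟩ := irr_prod Y hY D1 D2 h1 h2
  refine ⟨D1 * D2, ⟨v, hv, by rw [map_mul]; exact mul_ne_zero ha hb⟩, ?_⟩
  intro w hw
  rw [map_mul] at hw
  exact ⟨h1' w (left_ne_zero_of_mul hw), h2' w (right_ne_zero_of_mul hw)⟩

lemma Gen.mono {F : Type*} [Field F] {n k : ℕ} {Y : Set (Fin k → F)}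
    {P Q : (Fin n → Fin k → F) → Prop} (hP : Gen Y P) (h : ∀ v, P v → Q v) : Gen Y Q := by
  obtain ⟨D1, h1, h1'⟩ := hP
  exact ⟨D1, h1, fun v hv => h v (h1' v hv)⟩

lemma Gen.true {F : Type*} [Field F] {n k : ℕ} {Y : Set (Fin k → F)} (hne : Y.Nonempty)
    {P : (Fin n → Fin k → F) → Prop} (h : ∀ v, P v) : Gen Y P := by
  obtain ⟨y, hy⟩ := hne
  exact ⟨1, ⟨fun _ => y, fun _ => hy, by simp⟩, fun v _ => h v⟩

lemma Gen.all {F α : Type*} [Field F] {n k : ℕ} {Y : Set (Fin k → F)} (hY : Irr Y)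
    (hne : Y.Nonempty) (s : Finset α)
    {P : α → (Fin n → Fin k → F) → Prop} (h : ∀ a ∈ s, Gen Y (P a)) :
    Gen Y (fun v => ∀ a ∈ s, P a v) := by
  classical
  induction s using Finset.induction_on with
  | empty => exact Gen.true hne (by simp)
  | insert a s ha ih =>
    refine ((h a (by simp)).and hY (ih fun b hb => h b (by simp [hb]))).mono ?_
    rintro v ⟨h1, h2⟩ b hb
    rcases Finset.mem_insert.1 hb with rfl | hb
    · exact h1
    · exact h2 b hb

/-- Splitting along a tight set. -/
lemma good_split {ι L : Type*} [DecidableEq ι] [CommRing L] {n k : ℕ}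
    (U p : Finset ι) (hp : p ⊆ U) (S : Fin n → Finset ι) (σ : ι → ℕ) (x0 : ι) (hx0 : x0 ∈ p)
    (v : Fin n → Fin k → L) (h1 : Good p S σ v)
    (h2 : Good (insert x0 (U \ p)) (contr S p x0) σ v) : Good U S σ v := by
  intro u hu
  have hpc : ∀ i ∈ p, u i = u x0 := fun i hi => h1 u
    ⟨fun j i hi i' hi' => hu.1 j i (hp hi) i' (hp hi'),
      fun r i hi i' hi' => hu.2 r i (hp hi) i' (hp hi')⟩ i hi x0 hx0
  have hsub : insert x0 (U \ p) ⊆ U :=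
    Finset.insert_subset (hp hx0) Finset.sdiff_subset
  have hrep : ∀ j, ∀ i ∈ insert x0 (U \ p), i ∈ contr S p x0 j →
      ∃ i2 ∈ U, i2 ∈ S j ∧ u i2 = u i := by
    intro j i hi hij
    simp only [contr] at hij
    split_ifs at hij with hne
    · rcases Finset.mem_insert.1 hij with rfl | h
      · obtain ⟨y, hy⟩ := hne
        rw [Finset.mem_inter] at hy
        exact ⟨y, hp hy.2, hy.1, hpc y hy.2⟩
      · exact ⟨i, hsub hi, (Finset.mem_sdiff.1 h).1, rfl⟩
    · exact ⟨i, hsub hi, hij, rfl⟩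
  have hq := h2 u ⟨by
      intro j i hi i' hi' hij hij'
      obtain ⟨a, ha, haS, hau⟩ := hrep j i hi hij
      obtain ⟨b, hb, hbS, hbu⟩ := hrep j i' hi' hij'
      rw [← hau, ← hbu]
      exact hu.1 j a ha b hb haS hbS,
    fun r i hi i' hi' => hu.2 r i (hsub hi) i' (hsub hi')⟩
  have hall : ∀ i ∈ U, u i = u x0 := by
    intro i hi
    by_cases hip : i ∈ p
    · exact hpc i hip
    · exact hq i (by simp [hi, hip]) x0 (by simp)
  intro i hi i' hi'
  rw [hall i hi, hall i' hi']

/-- Degeneration: over the valued field, the system with the `j0`-th point generic is good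
as soon as the limit system is good. -/
lemma good_degenerate {ι F K Γ : Type*} [Fintype ι] [DecidableEq ι] [Field F] [Field K]
    [Algebra F K] [LinearOrderedCommGroupWithZero Γ] (val : Valuation K Γ)
    (hF : ∀ c : F, val (algebraMap F K c) ≤ 1)
    (hres : ∀ x, val x ≤ 1 → ∃ c : F, val (x - algebraMap F K c) < 1) {n k : ℕ}
    (f : Fin k → K) (hf0 : ∀ r, f r ≠ 0) (hf : ∀ r s, r < s → val (f s) < val (f r))
    (U : Finset ι) (S : Fin n → Finset ι) (σ : ι → ℕ) (j0 : Fin n) (root : ι)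
    (hroot : root ∈ U) (hrS : root ∈ S j0) (hrσ : ∀ i ∈ U, σ i ≤ σ root)
    (v : Fin n → Fin k → F)
    (h : Good U (Function.update S j0 ∅) (raise σ (S j0)) v) :
    Good U S σ (Function.update (fun j t => algebraMap F K (v j t)) j0 f) := by
  have hF1 : ∀ c : F, val (algebraMap F K c) < 1 → c = 0 := by
    intro c hc
    by_contra hne
    have h1 := hF c⁻¹
    rw [map_inv₀, map_inv₀] at h1
    have h0 : val (algebraMap F K c) ≠ 0 := by
      rw [Valuation.ne_zero_iff]; simpa using hne
    have h2 := (inv_le_one₀ (zero_lt_iff.2 h0)).1 h1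
    exact absurd hc (not_lt.2 h2)
  rw [good_iff U S σ root hroot]
  intro w hw
  rw [sysMat_ker] at hw
  obtain ⟨⟨hw1, hw2⟩, hw3⟩ := hw
  by_contra hne
  obtain ⟨x1, hx1⟩ : ∃ x, w x ≠ 0 := by
    by_contra! hc; exact hne (funext hc)
  obtain ⟨x, -, hxmax⟩ := Finset.exists_max_image Finset.univ (fun x => val (w x))
    ⟨x1, Finset.mem_univ _⟩
  have hxne : val (w x) ≠ 0 := by
    intro h0
    have := hxmax x1 (Finset.mem_univ _)
    simp only [h0] at this
    exact hx1 ((Valuation.zero_iff _).1 (le_zero_iff.1 this))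
  have hwx : w x ≠ 0 := (Valuation.ne_zero_iff _).1 hxne
  have hz : ∀ y, val (w y / w x) ≤ 1 := by
    intro y
    rw [map_div₀]; exact div_le_one_of_le₀ (hxmax y (Finset.mem_univ _)) zero_le
  have hc := fun y => hres _ (hz y)
  choose c hc using hc
  have hzero : ∀ y, val (w y) < val (w x) → c y = 0 := by
    intro y hy
    apply hF1
    have e : algebraMap F K (c y) = w y / w x - (w y / w x - algebraMap F K (c y)) := by ring
    rw [e]
    refine Valuation.map_sub_lt _ ?_ (hc y)
    rw [map_div₀]
    exact (div_lt_one₀ (zero_lt_iff.2 hxne)).2 hy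
  have hzero' : ∀ y, w y = 0 → c y = 0 := fun y hy => hzero y (by
    rw [hy, map_zero]; exact zero_lt_iff.2 hxne)
  have hflag : ∀ i ∈ U, ∀ r : Fin k, (r : ℕ) < σ i → w (i, r) = 0 := by
    intro i hi r hr
    have h1 := hw2 r i hi root hroot hr (lt_of_lt_of_le hr (hrσ i hi))
    exact h1.trans (hw3 root (Or.inr rfl) r)
  have hflag' : ∀ i ∈ U, ∀ r : Fin k, (r : ℕ) < raise σ (S j0) i → c (i, r) = 0 := by
    intro i hi r hr
    by_cases hlt : (r : ℕ) < σ i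
    · exact hzero' _ (hflag i hi r hlt)
    have hiS : i ∈ S j0 := by
      by_contra hiS
      simp only [raise, if_neg hiS] at hr
      exact hlt hr
    simp only [raise, if_pos hiS] at hr
    have hre : (r : ℕ) = σ i := by omega
    have h1 := hw1 j0 i hi root hroot hiS hrS
    simp only [Function.update_self] at h1
    have h0 : ∑ t, f t * w (root, t) = 0 :=
      Finset.sum_eq_zero fun t _ => by rw [hw3 root (Or.inr rfl) t, mul_zero]
    rw [h0, ← Finset.add_sum_erase _ _ (Finset.mem_univ r)] at h1
    apply hzero
    have h2 : f r * w (i, r) = -∑ t ∈ Finset.univ.erase r, f t * w (i, t) :=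
      eq_neg_of_add_eq_zero_left h1
    have hfr : val (f r) ≠ 0 := (Valuation.ne_zero_iff _).2 (hf0 r)
    have h3 : val (f r * w (i, r)) < val (f r) * val (w x) := by
      rw [h2, Valuation.map_neg]
      refine Valuation.map_sum_lt _ (mul_ne_zero hfr hxne) ?_
      intro t ht
      have htr : t ≠ r := Finset.ne_of_mem_erase ht
      rcases lt_or_gt_of_ne htr with hh' | hh'
      · rw [hflag i hi t (by rw [← hre]; exact hh'), mul_zero, map_zero]
        exact zero_lt_iff.2 (mul_ne_zero hfr hxne)
      · rw [map_mul]
        calc val (f t) * val (w (i, t)) ≤ val (f t) * val (w x) :=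
              mul_le_mul_of_nonneg_left (hxmax (i, t) (Finset.mem_univ _)) zero_le'
          _ < val (f r) * val (w x) :=
              (mul_lt_mul_iff_left₀ (zero_lt_iff.2 hxne)).2 (hf r t hh')
    rw [map_mul] at h3
    exact lt_of_mul_lt_mul_left' h3
  have hsol : Sol U (Function.update S j0 ∅) (raise σ (S j0)) v (fun i t => c (i, t)) := by
    refine ⟨?_, ?_⟩
    · intro j i hi i' hi' hij hij'
      have hj : j ≠ j0 := by
        rintro rfl
        simp at hij
      rw [Function.update_of_ne hj] at hij hij'
      have h1 := hw1 j i hi i' hi' hij hij'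
      simp only [Function.update_of_ne hj] at h1
      rw [← sub_eq_zero]
      apply hF1
      have hd : ∀ i, val (∑ t, algebraMap F K (v j t) * (w (i, t) / w x - algebraMap F K (c (i, t))))
          < 1 := by
        intro i
        refine Valuation.map_sum_lt _ one_ne_zero ?_
        intro t _
        rw [map_mul]
        exact lt_of_le_of_lt (mul_le_of_le_one_left' (hF _)) (hc _)
      have e : algebraMap F K (∑ t, v j t * c (i, t) - ∑ t, v j t * c (i', t)) =
          (∑ t, algebraMap F K (v j t) * (w (i', t) / w x - algebraMap F K (c (i', t)))) -
          ∑ t, algebraMap F K (v j t) * (w (i, t) / w x - algebraMap F K (c (i, t))) := by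
        have e1 : ∀ i, ∑ t, algebraMap F K (v j t) * (w (i, t) / w x) =
            (∑ t, algebraMap F K (v j t) * w (i, t)) / w x := by
          intro i
          rw [Finset.sum_div]
          exact Finset.sum_congr rfl fun t _ => by ring
        simp only [mul_sub, Finset.sum_sub_distrib, e1, h1, map_sub, map_sum, map_mul]
        ring
      rw [e]
      exact Valuation.map_sub_lt _ (hd i') (hd i)
    · intro r i hi i' hi' hr hr'
      change c (i, r) = c (i', r)
      rw [hflag' i hi r hr, hflag' i' hi' r hr']
  have hconst := h _ hsol
  have hcx : c x = 0 := by
    by_cases hxU : x.1 ∈ U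
    · have h1 := congrFun (hconst x.1 hxU root hroot) x.2
      exact h1.trans (hzero' _ (hw3 root (Or.inr rfl) _))
    · exact absurd (hw3 x.1 (Or.inl hxU) x.2) hwx
  have := hc x
  rw [hcx, div_self hwx] at this
  simp at this

/-- The induction measure. -/
def msr {ι : Type*} [DecidableEq ι] {n : ℕ} (U : Finset ι) (S : Fin n → Finset ι) : ℕ :=
  U.card + (Finset.univ.filter fun j => 2 ≤ (S j ∩ U).card).card

lemma hh_single {ι : Type*} [DecidableEq ι] {n : ℕ} (k : ℕ) (S : Fin n → Finset ι)
    (σ : ι → ℕ) (x : ι) : hh k S σ {x} = 0 := by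
  have : ∀ j, (S j ∩ {x}).card - 1 = 0 := by
    intro j
    have := Finset.card_le_card (Finset.inter_subset_right : S j ∩ {x} ⊆ {x})
    simp at this
    omega
  simp [hh, this]

lemma exists_argmax {ι : Type*} (σ : ι → ℕ) (p : Finset ι) (hp : p.Nonempty) :
    ∃ x ∈ p, σ x = p.sup σ := by
  obtain ⟨x, hx, h⟩ := Finset.exists_mem_eq_sup p hp σ
  exact ⟨x, hx, h.symm⟩

lemma contr_card_le {ι : Type*} [DecidableEq ι] {n : ℕ} (S : Fin n → Finset ι)
    (U p : Finset ι) (hp : p ⊆ U) (x0 : ι) (hx0 : x0 ∈ p) (j : Fin n) :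
    (contr S p x0 j ∩ insert x0 (U \ p)).card ≤ (S j ∩ U).card := by
  by_cases h : (S j ∩ p).Nonempty
  · have e : contr S p x0 j ∩ insert x0 (U \ p) ⊆ insert x0 ((S j ∩ U) \ p) := by
      intro i
      simp only [contr, h, if_true]
      simp
      tauto
    obtain ⟨y, hy⟩ := h
    have hyS := Finset.mem_inter.1 hy
    have e2 : insert y ((S j ∩ U) \ p) ⊆ S j ∩ U := by
      apply Finset.insert_subset
      · exact Finset.mem_inter.2 ⟨hyS.1, hp hyS.2⟩
      · exact Finset.sdiff_subset
    have c1 := Finset.card_le_card e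
    have c2 := Finset.card_le_card e2
    rw [Finset.card_insert_of_notMem (by simp [hyS.2])] at c2
    rw [Finset.card_insert_of_notMem (by simp [hx0])] at c1
    omega
  · apply Finset.card_le_card
    intro i
    simp only [contr, h, if_false]
    simp only [Finset.mem_inter, Finset.mem_insert, Finset.mem_sdiff]
    rintro ⟨h1, h2⟩
    refine ⟨h1, ?_⟩
    rcases h2 with h2 | h2
    · exact h2 ▸ hp hx0
    · exact h2.1

/-- The splitting step of the induction. -/
lemma gen_split {ι F : Type*} [DecidableEq ι] [Field F] {n k : ℕ} {Y : Set (Fin k → F)}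
    (hY : Irr Y) (U : Finset ι) (S : Fin n → Finset ι) (σ : ι → ℕ)
    (ih : ∀ (U' : Finset ι) (S' : Fin n → Finset ι), msr U' S' < msr U S → U'.Nonempty →
      (∀ p ⊆ U', p.Nonempty → 0 ≤ hh k S' σ p) → hh k S' σ U' = 0 →
      Gen Y (fun v => Good U' S' σ v))
    (hpos : ∀ p ⊆ U, p.Nonempty → 0 ≤ hh k S σ p) (hU : hh k S σ U = 0)
    (p : Finset ι) (hpU : p ⊆ U) (hp2 : 2 ≤ p.card) (hplt : p ≠ U) (hp0 : hh k S σ p = 0) :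
    Gen Y (fun v => Good U S σ v) := by
  have hpne : p.Nonempty := Finset.card_pos.1 (by omega)
  obtain ⟨x0, hx0, hxσ⟩ := exists_argmax σ p hpne
  have hcard : p.card < U.card := Finset.card_lt_card (Finset.ssubset_iff_subset_ne.2 ⟨hpU, hplt⟩)
  have hx0' : x0 ∉ U \ p := by simp [hx0]
  have hdis : Disjoint (U \ p) p := Finset.sdiff_disjoint
  have g1 : Gen Y (fun v => Good p S σ v) := by
    refine ih p S ?_ hpne (fun q hq hqn => hpos q (hq.trans hpU) hqn) hp0
    unfold msr
    have : (Finset.univ.filter fun j => 2 ≤ (S j ∩ p).card).card ≤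
        (Finset.univ.filter fun j => 2 ≤ (S j ∩ U).card).card := by
      apply Finset.card_le_card
      intro j
      simp only [Finset.mem_filter, Finset.mem_univ, true_and]
      intro h
      exact h.trans (Finset.card_le_card (Finset.inter_subset_inter_left hpU))
    omega
  have g2 : Gen Y (fun v => Good (insert x0 (U \ p)) (contr S p x0) σ v) := by
    refine ih _ _ ?_ ⟨x0, by simp⟩ ?_ ?_
    · unfold msr
      have : (Finset.univ.filter fun j => 2 ≤ (contr S p x0 j ∩ insert x0 (U \ p)).card).card ≤
          (Finset.univ.filter fun j => 2 ≤ (S j ∩ U).card).card := by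
        apply Finset.card_le_card
        intro j
        simp only [Finset.mem_filter, Finset.mem_univ, true_and]
        intro h
        exact h.trans (contr_card_le S U p hpU x0 hx0 j)
      rw [Finset.card_insert_of_notMem hx0']
      have := Finset.card_sdiff_add_card_eq_card hpU
      omega
    · intro q hq hqn
      by_cases hxq : x0 ∈ q
      · have hq0 : q.erase x0 ⊆ U \ p := by
          intro i hi
          have h1 := Finset.mem_erase.1 hi
          have := hq h1.2
          rw [Finset.mem_insert] at this
          exact this.resolve_left h1.1
        have hd : Disjoint (q.erase x0) p := hdis.mono_left hq0
        have := hh_contr k S σ p (q.erase x0) x0 hx0 hd hxσ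
        rw [Finset.insert_erase hxq] at this
        rw [this, hp0, sub_zero]
        apply hpos
        · exact Finset.union_subset (hq0.trans Finset.sdiff_subset) hpU
        · exact hpne.mono Finset.subset_union_right
      · have hq0 : q ⊆ U \ p := by
          intro i hi
          have := hq hi
          rw [Finset.mem_insert] at this
          exact this.resolve_left (fun e => hxq (e ▸ hi))
        rw [hh_contr_of_disjoint k S σ p q x0 hx0 (hdis.mono_left hq0)]
        exact hpos q (hq0.trans Finset.sdiff_subset) hqn
    · rw [hh_contr k S σ p (U \ p) x0 hx0 hdis hxσ, hp0, Finset.sdiff_union_of_subset hpU, hU,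
        sub_zero]
  refine (g1.and hY g2).mono ?_
  rintro v ⟨h1, h2⟩
  exact good_split U p hpU S σ x0 hx0 v h1 h2

/-- The main genericity theorem. -/
theorem gen_good {ι F K Γ : Type*} [Fintype ι] [DecidableEq ι] [Field F] [Field K]
    [Algebra F K] [LinearOrderedCommGroupWithZero Γ] (val : Valuation K Γ)
    (hF : ∀ c : F, val (algebraMap F K c) ≤ 1)
    (hres : ∀ x, val x ≤ 1 → ∃ c : F, val (x - algebraMap F K c) < 1) {n k : ℕ}
    (f : Fin k → K) (hf0 : ∀ r, f r ≠ 0) (hf : ∀ r s, r < s → val (f s) < val (f r))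
    {Y : Set (Fin k → F)} (hY : Irr Y) (hYne : Y.Nonempty)
    (hfY : ∀ D : MvPolynomial (Fin k) F, MvPolynomial.aeval f D ≠ 0 →
      ∃ y ∈ Y, MvPolynomial.eval y D ≠ 0) :
    ∀ (N : ℕ) (U : Finset ι) (S : Fin n → Finset ι) (σ : ι → ℕ), msr U S = N → U.Nonempty →
      (∀ p ⊆ U, p.Nonempty → 0 ≤ hh k S σ p) → hh k S σ U = 0 →
      Gen Y (fun v => Good U S σ v) := by
  intro N
  induction N using Nat.strong_induction_on with
  | _ N IH =>
  intro U S σ hN hUne hpos hU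
  have ih : ∀ (U' : Finset ι) (S' : Fin n → Finset ι), msr U' S' < msr U S → U'.Nonempty →
      (∀ p ⊆ U', p.Nonempty → 0 ≤ hh k S' σ p) → hh k S' σ U' = 0 →
      Gen Y (fun v => Good U' S' σ v) := fun U' S' h => IH _ (hN ▸ h) U' S' σ rfl
  by_cases hU1 : U.card = 1
  · obtain ⟨a, rfl⟩ := Finset.card_eq_one.1 hU1
    refine Gen.true hYne ?_
    intro v u _ i hi i' hi'
    rw [Finset.mem_singleton] at hi hi'
    rw [hi, hi']
  have hU2 : 2 ≤ U.card := by
    have := Finset.card_pos.2 hUne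
    omega
  obtain ⟨x0, hx0, hxσ⟩ := exists_argmax σ U hUne
  have hmax : ∀ x ∈ U, σ x ≤ σ x0 := fun x hx => hxσ ▸ Finset.le_sup (f := σ) hx
  by_cases hA : ∀ x ∈ U, x ≠ x0 → σ x < k
  · obtain ⟨j0, hj0, root, hrU, hrS, hrσ⟩ := exists_edge k S σ U hU2 hpos hU x0 hx0 hxσ hA
    by_cases hB : ∀ p ⊆ U, p.Nonempty → 0 ≤ hh k (Function.update S j0 ∅) (raise σ (S j0)) p
    · have hm : msr U (Function.update S j0 ∅) < N := by
        rw [← hN]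
        unfold msr
        apply Nat.add_lt_add_left
        apply Finset.card_lt_card
        rw [Finset.ssubset_iff_of_subset]
        · exact ⟨j0, by simp [hj0], by simp⟩
        · intro j
          by_cases hj : j = j0
          · subst hj; simp
          · simp [Function.update_of_ne hj]
      obtain ⟨D0, ⟨v, hv, hD0⟩, hD0'⟩ := IH _ hm U _ (raise σ (S j0)) rfl hUne hB
        ((hh_raise_eq k S σ j0 U ⟨root, hrU, hrS, hrσ⟩).trans hU)
      have hgood := good_degenerate val hF hres f hf0 hf U S σ j0 root hrU hrS
        (fun i hi => hrσ ▸ Finset.le_sup (f := σ) hi) v (hD0' v hD0)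
      obtain ⟨D, hD, hD'⟩ := good_open (F := F) U S σ hUne _ hgood
      rw [← aeval_substAt] at hD
      obtain ⟨y, hy, hyD⟩ := hfY _ hD
      rw [eval_substAt] at hyD
      refine ⟨D, ⟨_, ?_, hyD⟩, hD'⟩
      intro j
      by_cases hj : j = j0
      · subst hj; simpa using hy
      · rw [Function.update_of_ne hj]; exact hv j
    · push Not at hB
      obtain ⟨p, hpU, hpne, hp⟩ := hB
      have h0 := hpos p hpU hpne
      have h1 := hh_raise_ge k S σ j0 p
      have hp0 : hh k S σ p = 0 := by omega
      have hmiss : ¬ ∃ x ∈ p, x ∈ S j0 ∧ σ x = p.sup σ := by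
        intro h
        rw [hh_raise_eq k S σ j0 p h] at hp
        omega
      refine gen_split hY U S σ ih hpos hU p hpU ?_ ?_ hp0
      · by_contra hlt
        have : p.card = 1 := by
          have := Finset.card_pos.2 hpne
          omega
        obtain ⟨a, rfl⟩ := Finset.card_eq_one.1 this
        rw [hh_single] at hp
        omega
      · rintro rfl
        exact hmiss ⟨root, hrU, hrS, hrσ⟩
  · push Not at hA
    obtain ⟨x, hxU, hxne, hxk⟩ := hA
    have hpU : ({x0, x} : Finset ι) ⊆ U := by
      intro i hi
      simp at hi
      rcases hi with rfl | rfl <;> assumption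
    have hc : ({x0, x} : Finset ι).card = 2 := Finset.card_pair (Ne.symm hxne)
    by_cases hpe : ({x0, x} : Finset ι) = U
    · refine Gen.true hYne ?_
      intro v u hu i hi i' hi'
      have hk : ∀ i ∈ U, k ≤ σ i := by
        intro i hi
        rw [← hpe] at hi
        simp at hi
        rcases hi with rfl | rfl
        · exact hxk.trans (hmax x hxU)
        · exact hxk
      funext r
      exact hu.2 r i hi i' hi' (r.2.trans_le (hk i hi)) (r.2.trans_le (hk i' hi'))
    · refine gen_split hY U S σ ih hpos hU _ hpU hc.ge hpe ?_
      apply le_antisymm _ (hpos _ hpU ⟨x0, by simp⟩)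
      have hs : ({x0, x} : Finset ι).sup σ = σ x0 := by
        simp [hmax x hxU]
      have hsum : 0 ≤ ∑ j, (((S j ∩ {x0, x}).card - 1 : ℕ) : ℤ) :=
        Finset.sum_nonneg fun _ _ => by positivity
      unfold hh
      rw [hc, hs, Finset.sum_pair (Ne.symm hxne)]
      push_cast at hsum ⊢
      have : (k : ℤ) ≤ σ x := by exact_mod_cast hxk
      linarith

/-- The hyperedges attached to a family of sets. -/
def edges {ℓ n : ℕ} (A : Fin ℓ → Finset (Fin n)) : Fin n → Finset (Fin ℓ) :=
  fun j => Finset.univ.filter fun i => j ∉ A i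

lemma edges_hh {ℓ n k : ℕ} (A : Fin ℓ → Finset (Fin n)) (p : Finset (Fin ℓ)) :
    hh k (edges A) 0 p = (k : ℤ) * ((p.card : ℤ) - 1) - (n : ℤ) * p.card + ∑ i ∈ p, ((A i).card : ℤ)
      + n - (interSet A p).card := by
  have h1 : ∀ j, (((edges A j ∩ p).card - 1 : ℕ) : ℤ) = ((edges A j ∩ p).card : ℤ) -
      1 + (if j ∈ interSet A p then 1 else 0) := by
    intro j
    have : j ∈ interSet A p ↔ edges A j ∩ p = ∅ := by
      simp only [interSet, edges, Finset.mem_filter, Finset.mem_univ, true_and,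
        Finset.eq_empty_iff_forall_notMem, Finset.mem_inter]
      constructor
      · intro h i hi; exact hi.1 (h i hi.2)
      · intro h i hi; by_contra hc; exact h i ⟨hc, hi⟩
    by_cases hj : edges A j ∩ p = ∅
    · rw [if_pos (this.2 hj), hj]; simp
    · rw [if_neg (fun h => hj (this.1 h))]
      have := Finset.card_pos.2 (Finset.nonempty_iff_ne_empty.2 hj)
      omega
  have h2 : ∑ j, ((edges A j ∩ p).card : ℤ) = ∑ i ∈ p, ((n : ℤ) - (A i).card) := by
    have e1 : ∀ j, ((edges A j ∩ p).card : ℤ) = ∑ i ∈ p, if j ∈ A i then (0 : ℤ) else 1 := by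
      intro j
      have : edges A j ∩ p = p.filter (fun i => j ∉ A i) := by
        ext i; simp [edges, and_comm]
      rw [this, Finset.card_filter]
      push_cast
      refine Finset.sum_congr rfl fun i _ => ?_
      by_cases h : j ∈ A i <;> simp [h]
    simp only [e1]
    rw [Finset.sum_comm]
    refine Finset.sum_congr rfl fun i _ => ?_
    have : ∀ j, (if j ∈ A i then (0 : ℤ) else 1) = 1 - (if j ∈ A i then 1 else 0) := by
      intro j; split_ifs <;> simp
    simp [this]
  simp only [hh, h1, Finset.sum_add_distrib, Finset.sum_sub_distrib, h2]
  have h3 : p.sup (0 : Fin ℓ → ℕ) = 0 := by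
    apply Nat.le_zero.1
    apply Finset.sup_le
    simp
  rw [h3]
  simp
  ring

lemma null_part {ℓ n m : ℕ} (A : Fin ℓ → Finset (Fin n)) (h : NullInter m A)
    (p : Finset (Fin ℓ)) (hp : p.Nonempty) :
    (interSet A p).card + ∑ i ∈ pᶜ, (A i).card ≤ (ℓ - p.card) * m := by
  classical
  have := h ((⊥ : Finpartition pᶜ).extend (b := p) hp.ne_empty disjoint_compl_left
    (by simp))
  have hnot : p ∉ (⊥ : Finpartition pᶜ).parts := by
    intro hc
    have h1 := (⊥ : Finpartition pᶜ).le hc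
    obtain ⟨x, hx⟩ := hp
    have := h1 hx
    simp at this
    exact this hx
  rw [Finpartition.extend_parts, Finset.sum_insert hnot, Finset.card_insert_of_notMem hnot,
    Finpartition.parts_bot, Finset.sum_map, Finset.card_map, Finset.card_compl,
    Fintype.card_fin, Nat.add_sub_cancel] at this
  have e : ∀ i, interSet A ({i} : Finset (Fin ℓ)) = A i := by
    intro i; ext x; simp [interSet]
  simpa [e] using this

lemma edges_sparse {ℓ n k : ℕ} (hℓ : 2 ≤ ℓ) (hkn : k ≤ n) (A : Fin ℓ → Finset (Fin n))
    (hsum : (∑ i, (A i).card) = (ℓ - 1) * (n - k)) (h : NullInter (n - k) A) :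
    (∀ p ⊆ (Finset.univ : Finset (Fin ℓ)), p.Nonempty → 0 ≤ hh k (edges A) 0 p) ∧
      hh k (edges A) 0 Finset.univ = 0 ∧ interSet A Finset.univ = ∅ := by
  haveI : NeZero ℓ := ⟨by omega⟩
  have hun : (Finset.univ : Finset (Fin ℓ)).Nonempty := ⟨0, Finset.mem_univ _⟩
  have hun0 := null_part A h Finset.univ hun
  simp at hun0
  have hsz : (∑ i, ((A i).card : ℤ)) = ((ℓ : ℤ) - 1) * ((n : ℤ) - k) := by
    have := congrArg (Nat.cast : ℕ → ℤ) hsum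
    rw [Nat.cast_mul, Nat.cast_sub hkn, Nat.cast_sub (by omega : 1 ≤ ℓ)] at this
    push_cast at this
    exact this
  refine ⟨?_, ?_, hun0⟩
  · intro p _ hp
    rw [edges_hh]
    have h1 := null_part A h p hp
    have hple : p.card ≤ ℓ := by simpa using Finset.card_le_univ p
    have h2 : ((interSet A p).card : ℤ) + ∑ i ∈ pᶜ, ((A i).card : ℤ) ≤
        ((ℓ : ℤ) - p.card) * ((n : ℤ) - k) := by
      have : (((interSet A p).card + ∑ i ∈ pᶜ, (A i).card : ℕ) : ℤ) ≤
        (((ℓ - p.card) * (n - k) : ℕ) : ℤ) := by exact_mod_cast h1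
      rw [Nat.cast_mul, Nat.cast_sub hkn, Nat.cast_sub hple] at this
      push_cast at this
      exact this
    have h3 := Finset.sum_add_sum_compl p (fun i => ((A i).card : ℤ))
    rw [hsz] at h3
    linarith
  · rw [edges_hh, hun0, hsz]
    simp
    ring


/-- Linear change of coordinates on polynomials. -/
def trM {F : Type*} [Field F] {k : ℕ} (M : Matrix (Fin k) (Fin k) F)
    (D : MvPolynomial (Fin k) F) : MvPolynomial (Fin k) F :=
  MvPolynomial.aeval (fun r => ∑ t, MvPolynomial.C (M r t) * MvPolynomial.X t) D

lemma aeval_trM {F K : Type*} [Field F] [Field K] [Algebra F K] {k : ℕ}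
    (M : Matrix (Fin k) (Fin k) F) (D : MvPolynomial (Fin k) F) (x : Fin k → K) :
    MvPolynomial.aeval x (trM M D) =
      MvPolynomial.aeval (fun r => ∑ t, algebraMap F K (M r t) * x t) D := by
  rw [trM, ← AlgHom.comp_apply, MvPolynomial.comp_aeval]
  congr 2
  ext r
  simp

lemma eval_trM {F : Type*} [Field F] {k : ℕ}
    (M : Matrix (Fin k) (Fin k) F) (D : MvPolynomial (Fin k) F) (x : Fin k → F) :
    MvPolynomial.eval x (trM M D) = MvPolynomial.eval (M.mulVec x) D := by
  have := aeval_trM M D x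
  simp only [MvPolynomial.aeval_eq_eval, Algebra.algebraMap_self, RingHom.id_apply] at this
  exact this

lemma nullst {F : Type*} [Field F] [IsAlgClosed F] {k : ℕ}
    (I : Ideal (MvPolynomial (Fin k) F)) (hI : I.IsPrime)
    (X : Set (Fin k → F))
    (hX : X = {x : Fin k → F | ∀ g ∈ I, MvPolynomial.eval x g = 0})
    (D : MvPolynomial (Fin k) F) : D ∉ I ↔ ∃ x ∈ X, MvPolynomial.eval x D ≠ 0 := by
  constructor
  · intro h
    by_contra! hc
    apply h
    rw [← MvPolynomial.IsPrime.vanishingIdeal_zeroLocus (K := F) I]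
    intro x hx
    have : x ∈ X := by
      rw [hX]
      intro g hg
      have := hx g hg
      simpa [MvPolynomial.aeval_eq_eval] using this
    simpa [MvPolynomial.aeval_eq_eval] using hc x this
  · rintro ⟨x, hx, hD⟩ h
    rw [hX] at hx
    exact hD (hx D h)

lemma variety_gen {F : Type*} [Field F] [IsAlgClosed F] {k : ℕ}
    (I : Ideal (MvPolynomial (Fin k) F)) (hI : I.IsPrime)
    (X : Set (Fin k → F))
    (hX : X = {x : Fin k → F | ∀ g ∈ I, MvPolynomial.eval x g = 0})
    (hMDS : ∀ c : Fin k → F, c ≠ 0 → ∃ x ∈ X, (∑ t, c t * x t) ≠ 0) :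
    ∃ M : Matrix (Fin k) (Fin k) F, IsUnit M ∧ Irr (M.mulVec '' X) ∧ (M.mulVec '' X).Nonempty ∧
      ∀ (ℓ n : ℕ) (S : Fin n → Finset (Fin ℓ)), 0 < ℓ →
        (∀ p ⊆ (Finset.univ : Finset (Fin ℓ)), p.Nonempty → 0 ≤ hh k S 0 p) →
        hh k S 0 Finset.univ = 0 →
        Gen (M.mulVec '' X) (fun v => Good Finset.univ S 0 v) := by
  classical
  have := hI
  set R := MvPolynomial (Fin k) F ⧸ I with hR
  have : IsDomain R := Ideal.Quotient.isDomain I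
  set K := FractionRing R with hK
  set x : Fin k → K := fun t => algebraMap R K (Ideal.Quotient.mk I (MvPolynomial.X t)) with hx
  have hev : ∀ P : MvPolynomial (Fin k) F,
      MvPolynomial.aeval x P = algebraMap R K (Ideal.Quotient.mk I P) := by
    have : MvPolynomial.aeval x =
        (IsScalarTower.toAlgHom F R K).comp (Ideal.Quotient.mkₐ F I) := by
      apply MvPolynomial.algHom_ext
      intro i
      simp [hx]
      rfl
    intro P
    rw [this]
    rfl
  have hev0 : ∀ P : MvPolynomial (Fin k) F, MvPolynomial.aeval x P ≠ 0 ↔ P ∉ I := by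
    intro P
    rw [hev, Ne, FaithfulSMul.algebraMap_eq_zero_iff, Ideal.Quotient.eq_zero_iff_mem]
  have hlin : LinearIndependent F x := by
    rw [Fintype.linearIndependent_iff]
    intro c hc
    by_contra! hne
    have hc0 : c ≠ 0 := by
      rintro rfl
      simp at hne
    have hmem : (∑ t, MvPolynomial.C (c t) * MvPolynomial.X t : MvPolynomial (Fin k) F) ∉ I := by
      rw [nullst I hI X hX]
      obtain ⟨y, hy, hyc⟩ := hMDS c hc0
      exact ⟨y, hy, by simpa using hyc⟩
    rw [← hev0] at hmem
    apply hmem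
    rw [← hc]
    simp [Algebra.smul_def]
  obtain ⟨O, hO1, hO2⟩ := exists_good_valuationSubring F K
  have hF : ∀ c : F, O.valuation (algebraMap F K c) ≤ 1 := fun c =>
    (O.valuation_le_one_iff _).2 (hO1 c)
  have hres : ∀ z, O.valuation z ≤ 1 → ∃ c : F, O.valuation (z - algebraMap F K c) < 1 :=
    fun z hz => hO2 z ((O.valuation_le_one_iff _).1 hz)
  obtain ⟨M, hM, hM0, hMlt⟩ := exists_adapted_matrix O.valuation hF hres k x hlin
  have hYX : ∀ D : MvPolynomial (Fin k) F, (∃ y ∈ M.mulVec '' X, MvPolynomial.eval y D ≠ 0) ↔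
      trM M D ∉ I := by
    intro D
    rw [nullst I hI X hX]
    simp [eval_trM]
  have hXne : (M.mulVec '' X).Nonempty := by
    have : (1 : MvPolynomial (Fin k) F) ∉ I := (Ideal.ne_top_iff_one I).1 hI.ne_top
    rw [nullst I hI X hX] at this
    obtain ⟨y, hy, _⟩ := this
    exact ⟨_, y, hy, rfl⟩
  have hIrr : Irr (M.mulVec '' X) := by
    intro D1 D2 h1 h2
    rw [hYX] at h1 h2
    have : trM M D1 * trM M D2 ∉ I := fun h => (hI.mem_or_mem h).elim h1 h2
    rw [nullst I hI X hX] at this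
    obtain ⟨y, hy, hy'⟩ := this
    rw [map_mul, eval_trM, eval_trM] at hy'
    exact ⟨_, ⟨y, hy, rfl⟩, left_ne_zero_of_mul hy', right_ne_zero_of_mul hy'⟩
  refine ⟨M, hM, hIrr, hXne, ?_⟩
  intro ℓ n S hℓ hpos h0
  have : NeZero ℓ := ⟨hℓ.ne'⟩
  refine gen_good O.valuation hF hres (fun r => ∑ t, algebraMap F K (M r t) * x t) hM0 hMlt
    hIrr hXne ?_ _ Finset.univ S 0 rfl ⟨0, Finset.mem_univ _⟩ hpos h0
  intro D hD
  rw [hYX, ← hev0, aeval_trM]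
  exact hD


lemma good_transfer {ι F : Type*} [Field F] {n k : ℕ} (U : Finset ι) (S : Fin n → Finset ι)
    (M : Matrix (Fin k) (Fin k) F) (hM : IsUnit M) (x : Fin n → Fin k → F)
    (h : Good U S 0 (fun j => M.mulVec (x j))) : Good U S 0 x := by
  intro u hu
  have hdet : IsUnit M.det := (Matrix.isUnit_iff_isUnit_det M).1 hM
  have key : ∀ i, (u i ᵥ* M⁻¹) ᵥ* M = u i := by
    intro i
    rw [Matrix.vecMul_vecMul, Matrix.nonsing_inv_mul M hdet, Matrix.vecMul_one]
  have e : ∀ j i, ∑ t, (M.mulVec (x j)) t * (u i ᵥ* M⁻¹) t = ∑ t, x j t * u i t := by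
    intro j i
    change (M *ᵥ x j) ⬝ᵥ (u i ᵥ* M⁻¹) = x j ⬝ᵥ u i
    rw [dotProduct_comm, Matrix.dotProduct_mulVec, key, dotProduct_comm]
  have := h (fun i => u i ᵥ* M⁻¹) ⟨?_, ?_⟩
  · intro i hi i' hi'
    rw [← key i, ← key i']
    rw [this i hi i' hi']
  · intro j i hi i' hi' hs hs'
    simp only [e]
    exact hu.1 j i hi i' hi' hs hs'
  · intro r i _ i' _ h
    simp at h

lemma rank_of_good {F : Type*} [Field F] {n k : ℕ} (S : Fin n → Finset (Fin 2))
    (v : Fin n → Fin k → F) (h : Good Finset.univ S 0 v) :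
    (Matrix.of fun (i : Fin k) (j : Fin n) => v j i).rank = k := by
  rw [← Matrix.rank_transpose]
  have hinj : Function.Injective
      (Matrix.of fun (i : Fin k) (j : Fin n) => v j i)ᵀ.mulVecLin := by
    rw [← LinearMap.ker_eq_bot, LinearMap.ker_eq_bot']
    intro u hu
    have := h ![u, 0] ⟨?_, ?_⟩ 0 (Finset.mem_univ _) 1 (Finset.mem_univ _)
    · simpa using this
    · intro j
      have hj : ∑ t, v j t * u t = 0 := by
        exact congrFun hu j
      have : ∀ i : Fin 2, ∑ t, v j t * (![u, 0] : Fin 2 → Fin k → F) i t = 0 := by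
        intro i
        fin_cases i
        · simpa using hj
        · simp
      intro i _ i' _ _ _
      rw [this, this]
    · intro r i _ i' _ h
      simp at h
  rw [Matrix.rank, LinearMap.finrank_range_of_inj hinj]
  simp

lemma rank_edges_hh {n k : ℕ} (hkn : k ≤ n) :
    (∀ p ⊆ (Finset.univ : Finset (Fin 2)), p.Nonempty → 0 ≤
      hh k (fun j : Fin n => if (j : ℕ) < k then (Finset.univ : Finset (Fin 2)) else ∅) 0 p) ∧
      hh k (fun j : Fin n => if (j : ℕ) < k then (Finset.univ : Finset (Fin 2)) else ∅) 0
        Finset.univ = 0 := by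
  have huniv : hh k (fun j : Fin n => if (j : ℕ) < k then (Finset.univ : Finset (Fin 2)) else ∅) 0
        Finset.univ = 0 := by
    have e : ∀ j : Fin n, ((((if (j : ℕ) < k then (Finset.univ : Finset (Fin 2)) else ∅)
        ∩ Finset.univ).card - 1 : ℕ) : ℤ) = if (j : ℕ) < k then 1 else 0 := by
      intro j
      split_ifs <;> simp
    have hc : (Finset.univ.filter fun j : Fin n => (j : ℕ) < k).card = k := by
      have := Fin.card_filter_val_lt (n := n) (m := k)
      simpa [hkn] using this
    have h3 : (Finset.univ : Finset (Fin 2)).sup (0 : Fin 2 → ℕ) = 0 := by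
      apply Nat.le_zero.1
      apply Finset.sup_le
      simp
    simp only [hh, e]
    rw [h3, Finset.sum_boole, hc]
    simp
  refine ⟨?_, huniv⟩
  intro p _ hp
  by_cases h2 : p.card = 2
  · have : p = Finset.univ := by
      rw [← Finset.card_eq_iff_eq_univ]; simpa using h2
    rw [this, huniv]
  · have h1 : p.card = 1 := by
      have := Finset.card_pos.2 hp
      have := Finset.card_le_univ p
      simp at this
      omega
    obtain ⟨a, rfl⟩ := Finset.card_eq_one.1 h1
    rw [hh_single]

lemma dual_inter {F : Type*} [Field F] {n k ℓ : ℕ} (hℓ : 2 ≤ ℓ) (hkn : k ≤ n)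
    (v : Fin n → Fin k → F)
    (hV : (Matrix.of fun (i : Fin k) (j : Fin n) => v j i).rank = k)
    (Q : Matrix (Fin (n - k)) (Fin n) F) (hQ : Q.rank = n - k)
    (hVQ : (Matrix.of fun (i : Fin k) (j : Fin n) => v j i) * Qᵀ = 0)
    (A : Fin ℓ → Finset (Fin n)) (hA : interSet A Finset.univ = ∅)
    (h : Good Finset.univ (edges A) 0 v) : (⨅ i, colSpan Q (A i)) = ⊥ := by
  classical
  have : NeZero ℓ := ⟨by omega⟩
  set V := (Matrix.of fun (i : Fin k) (j : Fin n) => v j i) with hVdef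
  have hker : LinearMap.range Vᵀ.mulVecLin = LinearMap.ker Q.mulVecLin := by
    apply Submodule.eq_of_le_of_finrank_eq
    · rintro _ ⟨u, rfl⟩
      rw [LinearMap.mem_ker, Matrix.mulVecLin_apply, Matrix.mulVecLin_apply, Matrix.mulVec_mulVec]
      have : Q * Vᵀ = 0 := by
        rw [← Matrix.transpose_inj, Matrix.transpose_mul, Matrix.transpose_transpose, hVQ,
          Matrix.transpose_zero]
      rw [this, Matrix.zero_mulVec]
    · have h1 := LinearMap.finrank_range_add_finrank_ker Q.mulVecLin
      have h2 : Module.finrank F (LinearMap.range Q.mulVecLin) = n - k := hQ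
      have h3 : Module.finrank F (LinearMap.range Vᵀ.mulVecLin) = k := by
        rw [← Matrix.rank_transpose] at hV
        exact hV
      rw [h2] at h1
      simp at h1
      omega
  rw [eq_bot_iff]
  intro y hy
  rw [Submodule.mem_iInf] at hy
  have hw : ∀ i, ∃ w : Fin n → F, (∀ j, j ∉ A i → w j = 0) ∧ Q.mulVec w = y := by
    intro i
    have := hy i
    unfold colSpan at this
    rw [Submodule.mem_span_image_finset_iff_exists_fun] at this
    obtain ⟨c, hc⟩ := this
    refine ⟨fun j => if h : j ∈ A i then c ⟨j, h⟩ else 0, fun j hj => by simp [hj], ?_⟩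
    rw [← hc]
    ext r
    simp only [Matrix.mulVec, dotProduct, Finset.sum_apply, Pi.smul_apply, smul_eq_mul]
    rw [← Finset.sum_subset (Finset.subset_univ (A i))]
    · rw [← Finset.sum_coe_sort (A i)]
      refine Finset.sum_congr rfl fun j hj => ?_
      rw [dif_pos j.2, mul_comm]
    · intro j _ hj
      simp [hj]
  choose w hw0 hwy using hw
  have hu : ∀ i, ∃ u : Fin k → F, Vᵀ.mulVec u = w i - w 0 := by
    intro i
    have : w i - w 0 ∈ LinearMap.ker Q.mulVecLin := by
      rw [LinearMap.mem_ker, Matrix.mulVecLin_apply, Matrix.mulVec_sub, hwy, hwy, sub_self]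
    rw [← hker] at this
    exact this
  choose u hu using hu
  have huj : ∀ i j, ∑ t, v j t * u i t = w i j - w 0 j := by
    intro i j
    exact congrFun (hu i) j
  have hconst := h u ⟨?_, ?_⟩
  · have hweq : ∀ i, w i = w 0 := by
      intro i
      have h1 := hu i
      rw [hconst i (Finset.mem_univ _) 0 (Finset.mem_univ _), hu 0, sub_self] at h1
      exact (sub_eq_zero.1 h1.symm)
    have hz : w 0 = 0 := by
      ext j
      have : j ∉ interSet A Finset.univ := by rw [hA]; simp
      simp [interSet] at this
      obtain ⟨i, hi⟩ := this
      rw [← hweq i]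
      exact hw0 i j hi
    rw [Submodule.mem_bot, ← hwy 0, hz, Matrix.mulVec_zero]
  · intro j i _ i' _ hi hi'
    simp [edges] at hi hi'
    rw [huj, huj, hw0 i j hi, hw0 i' j hi']
  · intro r i _ i' _ h
    simp at h

/-- An irreducible MDS variety is `LD-MDS(≤ L)` for all `L`: if the zero locus `X` of a
prime ideal is not contained in any hyperplane through the origin, then for every `ℓ ≥ 2`
there are points of `X` whose matrix has rank `k` and all of whose dual matrices are
`MDS(ℓ)`. -/
theorem irreducible_MDS_variety_is_LD_MDS
    (F : Type*) [Field F] [IsAlgClosed F] (k n : ℕ) (hk : 1 ≤ k) (hkn : k ≤ n)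
    (I : Ideal (MvPolynomial (Fin k) F)) (hI : I.IsPrime)
    (X : Set (Fin k → F))
    (hX : X = {x : Fin k → F | ∀ g ∈ I, MvPolynomial.eval x g = 0})
    (hMDS : ∀ c : Fin k → F, c ≠ 0 → ∃ x ∈ X, (∑ t, c t * x t) ≠ 0) :
    ∀ ℓ : ℕ, 2 ≤ ℓ →
      ∃ v : Fin n → (Fin k → F), (∀ j, v j ∈ X) ∧
        (Matrix.of fun (i : Fin k) (j : Fin n) => v j i).rank = k ∧
        ∀ Q : Matrix (Fin (n - k)) (Fin n) F, Q.rank = n - k →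
          (Matrix.of fun (i : Fin k) (j : Fin n) => v j i) * Qᵀ = 0 →
          ∀ A : Fin ℓ → Finset (Fin n),
            (∀ i, (A i).card ≤ n - k) →
            (∑ i, (A i).card) = (ℓ - 1) * (n - k) →
            NullInter (n - k) A →
            (⨅ i, colSpan Q (A i)) = ⊥ := by
  intro ℓ hℓ
  classical
  obtain ⟨M, hM, hIrr, hne, hgen⟩ := variety_gen I hI X hX hMDS
  have hr := rank_edges_hh (n := n) hkn
  have g1 := hgen 2 n _ (by norm_num) hr.1 hr.2
  have g2 : Gen (M.mulVec '' X) (fun v : Fin n → Fin k → F =>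
      ∀ A ∈ (Finset.univ : Finset (Fin ℓ → Finset (Fin n))),
        (∑ i, (A i).card) = (ℓ - 1) * (n - k) → NullInter (n - k) A →
          Good Finset.univ (edges A) 0 v) := by
    refine Gen.all hIrr hne _ ?_
    intro A _
    by_cases h1 : (∑ i, (A i).card) = (ℓ - 1) * (n - k)
    · by_cases h2 : NullInter (n - k) A
      · have hs := edges_sparse hℓ hkn A h1 h2
        exact (hgen ℓ n (edges A) (by omega) hs.1 hs.2.1).mono fun v hv _ _ => hv
      · exact Gen.true hne fun v _ h => absurd h h2
    · exact Gen.true hne fun v h => absurd h h1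
  obtain ⟨D, ⟨y, hy, hD⟩, hD'⟩ := g1.and hIrr g2
  have hgood := hD' y hD
  choose x hx hxy using hy
  have hyx : y = fun j => M.mulVec (x j) := funext fun j => (hxy j).symm
  rw [hyx] at hgood
  have hrank := rank_of_good _ x (good_transfer _ _ M hM x hgood.1)
  refine ⟨x, hx, hrank, ?_⟩
  intro Q hQ hVQ A _ hsum hnull
  exact dual_inter hℓ hkn x hrank Q hQ hVQ A (edges_sparse hℓ hkn A hsum hnull).2.2
    (good_transfer _ _ M hM x (hgood.2 A (Finset.mem_univ _) hsum hnull))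
end
end
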